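/- Comparison principle for infima of convex Hamiltonians: let A satisfy (A1)–(A2) and let H ∈ ℋ(m, Λ, (a_r), (M_r)) be of the form H(x,p) = inf_{i∈I} H_i(x,p) for all (x,p) ∈ ℝ^d × ℝ^d, where I is a set of indices and each H_i belongs to 𝔅(m_i, Λ, (a_r), (M_r)) for some exponent m_i > 1. Let U ⊆ ℝ^d be open, let v be upper semicontinuous on [0,T]×cl(U) and a viscosity subsolution of ∂_t u − tr(A(x) D_x² u) + H(x, D_x u) = 0 in (0,T)×U, and let w be lower semicontinuous on [0,T]×cl(U) and a viscosity supersolution of the same equation; assume the sublinear growth condition holds. Then v(t,x) − w(t,x) ≤ sup_{∂_P((0,T)×U)} (v − w) for every (t,x) ∈ (0,T)×U. -/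

import Mathlib

open Set Metric Filter
open scoped ENNReal NNReal RealInnerProductSpace

noncomputable section

abbrev Euc (d : ℕ) := EuclideanSpace ℝ (Fin d)

/-- Time partial derivative `∂_t u (t,x)`. -/
def timeDeriv (d : ℕ) (u : ℝ × Euc d → ℝ) (t : ℝ) (x : Euc d) : ℝ :=
  deriv (fun s => u (s, x)) t

/-- Spatial partial derivative `∂_{x_i} u (t,x)`. -/
def spacePartial (d : ℕ) (i : Fin d) (u : ℝ × Euc d → ℝ) (t : ℝ) (x : Euc d) : ℝ :=
  fderiv ℝ (fun y => u (t, y)) x (EuclideanSpace.single i 1)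

/-- Spatial gradient `D_x u (t,x)`. -/
def spaceGrad (d : ℕ) (u : ℝ × Euc d → ℝ) (t : ℝ) (x : Euc d) : Euc d :=
  (EuclideanSpace.equiv (Fin d) ℝ).symm (fun i => spacePartial d i u t x)

/-- Spatial Hessian matrix `D_x² u (t,x)`. -/
def spaceHessian (d : ℕ) (u : ℝ × Euc d → ℝ) (t : ℝ) (x : Euc d) :
    Matrix (Fin d) (Fin d) ℝ :=
  Matrix.of fun i j => spacePartial d i (fun p => spacePartial d j u p.1 p.2) t x

/-- The quasilinear parabolic operator `∂_t u - tr(A(x) D_x² u) + H(x, D_x u)`. -/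
def parabolicOp (d : ℕ) (A : Euc d → Matrix (Fin d) (Fin d) ℝ) (H : Euc d → Euc d → ℝ)
    (u : ℝ × Euc d → ℝ) (t : ℝ) (x : Euc d) : ℝ :=
  timeDeriv d u t x - Matrix.trace (A x * spaceHessian d u t x) + H x (spaceGrad d u t x)

/-- Viscosity subsolution of `∂_t u - tr(A(x) D_x² u) + H(x, D_x u) = 0` in `(0,T) × U`. -/
def IsViscSubsolution (d : ℕ) (A : Euc d → Matrix (Fin d) (Fin d) ℝ)
    (H : Euc d → Euc d → ℝ) (T : ℝ) (U : Set (Euc d)) (v : ℝ × Euc d → ℝ) : Prop :=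
  ∀ φ : ℝ × Euc d → ℝ, ContDiff ℝ 2 φ → ∀ t₀ ∈ Ioo (0 : ℝ) T, ∀ x₀ ∈ U,
    IsLocalMaxOn (fun p => v p - φ p) (Ioo 0 T ×ˢ U) (t₀, x₀) →
    parabolicOp d A H φ t₀ x₀ ≤ 0

/-- Viscosity supersolution of `∂_t u - tr(A(x) D_x² u) + H(x, D_x u) = 0` in `(0,T) × U`. -/
def IsViscSupersolution (d : ℕ) (A : Euc d → Matrix (Fin d) (Fin d) ℝ)
    (H : Euc d → Euc d → ℝ) (T : ℝ) (U : Set (Euc d)) (w : ℝ × Euc d → ℝ) : Prop :=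
  ∀ φ : ℝ × Euc d → ℝ, ContDiff ℝ 2 φ → ∀ t₀ ∈ Ioo (0 : ℝ) T, ∀ x₀ ∈ U,
    IsLocalMinOn (fun p => w p - φ p) (Ioo 0 T ×ˢ U) (t₀, x₀) →
    0 ≤ parabolicOp d A H φ t₀ x₀

/-- Frobenius norm of a real matrix. -/
def matFrobNorm {k l : ℕ} (Mm : Matrix (Fin k) (Fin l) ℝ) : ℝ :=
  Real.sqrt (∑ i, ∑ j, (Mm i j) ^ 2)

/-- Conditions (A1)–(A2): `A = σ σᵀ` with `σ` bounded and Lipschitz with constant `Λ_A`. -/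
def CondA (d : ℕ) (ΛA : ℝ) (A : Euc d → Matrix (Fin d) (Fin d) ℝ) : Prop :=
  ∃ n : ℕ, ∃ σ : Euc d → Matrix (Fin d) (Fin n) ℝ,
    (∀ x, A x = σ x * (σ x).transpose) ∧
    (∀ x, matFrobNorm (σ x) ≤ ΛA) ∧
    (∀ x y, matFrobNorm (σ x - σ y) ≤ ΛA * ‖x - y‖)

/-- Condition (A3): entries of `A` are `C¹`. -/
def CondA3 (d : ℕ) (A : Euc d → Matrix (Fin d) (Fin d) ℝ) : Prop :=
  ∀ i j, ContDiff ℝ 1 (fun x : Euc d => A x i j)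

/-- Condition (A4): uniform ellipticity `⟨A(x)ξ, ξ⟩ ≥ λ|ξ|²`. -/
def CondA4 (d : ℕ) (lam : ℝ) (A : Euc d → Matrix (Fin d) (Fin d) ℝ) : Prop :=
  ∀ x ξ : Euc d, lam * ‖ξ‖ ^ 2 ≤ ∑ i, ∑ j, A x i j * ξ j * ξ i

/-- Condition (H3). -/
def CondH3 (d : ℕ) (m Λ : ℝ) (H : Euc d → Euc d → ℝ) : Prop :=
  ∀ x p q : Euc d, |H x p - H x q| ≤ Λ * (‖p‖ + ‖q‖ + 1) ^ (m - 1) * ‖p - q‖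

/-- Condition (H4) with parameter `μ`. -/
def CondH4 (d : ℕ) (m Λ μ : ℝ) (a M : ℝ → ℝ) (H : Euc d → Euc d → ℝ) : Prop :=
  ∀ r : ℝ, 0 < r →
    (a r ∈ Ioc (0 : ℝ) 1 ∧ 1 ≤ M r) ∧
    (∀ x ∈ ball (0 : Euc d) r, ∀ p : Euc d,
      max (-μ) (a r * ‖p‖ ^ m - M r) ≤ H x p ∧ H x p ≤ Λ * (‖p‖ ^ m + 1)) ∧
    (∀ x ∈ ball (0 : Euc d) r, ∀ y ∈ ball (0 : Euc d) r, ∀ p : Euc d,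
      |H x p - H y p| ≤ (Λ * ‖p‖ ^ m + M r) * ‖x - y‖)

/-- Condition (H4) with `μ = +∞`. -/
def CondH4top (d : ℕ) (m Λ : ℝ) (a M : ℝ → ℝ) (H : Euc d → Euc d → ℝ) : Prop :=
  ∀ r : ℝ, 0 < r →
    (a r ∈ Ioc (0 : ℝ) 1 ∧ 1 ≤ M r) ∧
    (∀ x ∈ ball (0 : Euc d) r, ∀ p : Euc d,
      a r * ‖p‖ ^ m - M r ≤ H x p ∧ H x p ≤ Λ * (‖p‖ ^ m + 1)) ∧
    (∀ x ∈ ball (0 : Euc d) r, ∀ y ∈ ball (0 : Euc d) r, ∀ p : Euc d,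
      |H x p - H y p| ≤ (Λ * ‖p‖ ^ m + M r) * ‖x - y‖)

/-- `limsup_{|x|→∞, x∈U} sup_{t∈[0,T]} v(t,x)/(1+|x|) ≤ 0`. -/
def SublinearAbove (d : ℕ) (T : ℝ) (U : Set (Euc d)) (v : ℝ × Euc d → ℝ) : Prop :=
  ∀ ε : ℝ, 0 < ε → ∃ R : ℝ, ∀ x ∈ U, R ≤ ‖x‖ → ∀ t ∈ Icc (0 : ℝ) T, v (t, x) ≤ ε * (1 + ‖x‖)

/-- `liminf_{|x|→∞, x∈U} inf_{t∈[0,T]} w(t,x)/(1+|x|) ≥ 0`. -/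
def SublinearBelow (d : ℕ) (T : ℝ) (U : Set (Euc d)) (w : ℝ × Euc d → ℝ) : Prop :=
  ∀ ε : ℝ, 0 < ε → ∃ R : ℝ, ∀ x ∈ U, R ≤ ‖x‖ → ∀ t ∈ Icc (0 : ℝ) T, -(ε * (1 + ‖x‖)) ≤ w (t, x)

/-- Parabolic boundary `({0} × U) ∪ ([0,T) × ∂U)`. -/
def parabolicBoundary (d : ℕ) (T : ℝ) (U : Set (Euc d)) : Set (ℝ × Euc d) :=
  ({0} ×ˢ U) ∪ (Ico 0 T ×ˢ frontier U)

/-- The families `(a_r)_{r>0} ⊆ (0,1]` and `(M_r)_{r>0} ⊆ [1,+∞)`. -/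
def GoodFamilies (a M : ℝ → ℝ) : Prop :=
  ∀ r : ℝ, 0 < r → a r ∈ Ioc (0 : ℝ) 1 ∧ 1 ≤ M r

/-- The class `𝔅(m, Λ, (a_r), (M_r))`: Borel functions `F(x,p)`, convex in `p`,
satisfying (H3) and the growth condition `a_r|p|^m - M_r ≤ F(x,p) ≤ Λ(|p|^m + 1)`
for `x ∈ B_r`. -/
def MemB (d : ℕ) (m Λ : ℝ) (a M : ℝ → ℝ) (F : Euc d → Euc d → ℝ) : Prop :=
  Measurable (fun q : Euc d × Euc d => F q.1 q.2) ∧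
  (∀ x : Euc d, ConvexOn ℝ univ (F x)) ∧
  (∀ x p q : Euc d, |F x p - F x q| ≤ Λ * (‖p‖ + ‖q‖ + 1) ^ (m - 1) * ‖p - q‖) ∧
  (∀ r : ℝ, 0 < r → ∀ x ∈ ball (0 : Euc d) r, ∀ p : Euc d,
    a r * ‖p‖ ^ m - M r ≤ F x p ∧ F x p ≤ Λ * (‖p‖ ^ m + 1))

/-- The class `ℋ(m, Λ, (a_r), (M_r))`: Hamiltonians satisfying (H3) and (H4) with
`μ = +∞`. -/
def MemH (d : ℕ) (m Λ : ℝ) (a M : ℝ → ℝ) (H : Euc d → Euc d → ℝ) : Prop :=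
  (∀ x p q : Euc d, |H x p - H x q| ≤ Λ * (‖p‖ + ‖q‖ + 1) ^ (m - 1) * ‖p - q‖) ∧
  (∀ r : ℝ, 0 < r →
    (∀ x ∈ ball (0 : Euc d) r, ∀ p : Euc d,
      a r * ‖p‖ ^ m - M r ≤ H x p ∧ H x p ≤ Λ * (‖p‖ ^ m + 1)) ∧
    (∀ x ∈ ball (0 : Euc d) r, ∀ y ∈ ball (0 : Euc d) r, ∀ p : Euc d,
      |H x p - H y p| ≤ (Λ * ‖p‖ ^ m + M r) * ‖x - y‖))

section Part1

/-! ### Part 1: a Jensen–Alexandrov lemma -/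

section JensenAlexandrov

open MeasureTheory

variable {Z : Type*} [NormedAddCommGroup Z] [InnerProductSpace ℝ Z]

/-- A convex function touched from above by a paraboloid is above the tangent plane. -/
theorem ja_lower {g : Z → ℝ} (hg : ConvexOn ℝ univ g) {k : ℝ} (hk : 0 ≤ k) {z P : Z}
    (hup : ∀ y, g y ≤ g z + ⟪P, y - z⟫ + k / 2 * ‖y - z‖ ^ 2) (y : Z) :
    g z + ⟪P, y - z⟫ ≤ g y := by
  by_contra hcon
  push Not at hcon
  set D := g z + ⟪P, y - z⟫ - g y with hD
  have hDpos : 0 < D := by rw [hD]; linarith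
  set C := k / 2 * ‖y - z‖ ^ 2 with hC
  have hC0 : 0 ≤ C := by positivity
  -- choose s small
  set s := D / (2 * (C + 1)) with hs
  have hs0 : 0 < s := by positivity
  have hsC : s * C < D := by
    rw [hs, div_mul_eq_mul_div, div_lt_iff₀ (by positivity)]
    nlinarith
  have h1 : g ((s / (1 + s)) • y + (1 / (1 + s)) • (z - s • (y - z))) ≤
      (s / (1 + s)) • g y + (1 / (1 + s)) • g (z - s • (y - z)) :=
    hg.2 (mem_univ y) (mem_univ (z - s • (y - z))) (by positivity) (by positivity)
      (by field_simp; ring)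
  have hz : (s / (1 + s)) • y + (1 / (1 + s)) • (z - s • (y - z)) = z := by
    have h1s : (1 + s) ≠ 0 := by positivity
    have : (s / (1 + s)) • y + (1 / (1 + s)) • (z - s • (y - z))
        = ((s / (1 + s)) - (1 / (1 + s)) * s) • y + ((1 / (1 + s)) + (1 / (1 + s)) * s) • z := by
      module
    rw [this]
    have e1 : (s / (1 + s)) - (1 / (1 + s)) * s = 0 := by field_simp; ring
    have e2 : (1 / (1 + s)) + (1 / (1 + s)) * s = 1 := by field_simp
    rw [e1, e2]; simp
  rw [hz] at h1
  have h2 := hup (z - s • (y - z))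
  have e3 : z - s • (y - z) - z = -(s • (y - z)) := by abel
  rw [e3, norm_neg, norm_smul, inner_neg_right, inner_smul_right, Real.norm_of_nonneg hs0.le] at h2
  have h3 : (1 + s) * g z ≤ s * g y + g (z - s • (y - z)) := by
    have h1s : 0 < (1 + s) := by positivity
    simp only [smul_eq_mul] at h1
    have := mul_le_mul_of_nonneg_left h1 h1s.le
    have e4 : (1 + s) * (s / (1 + s) * g y + 1 / (1 + s) * g (z - s • (y - z)))
      = s * g y + g (z - s • (y - z)) := by field_simp
    linarith
  have h4 : s * D ≤ s * (s * C) := by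
    rw [hD, hC]; nlinarith
  have h5 : D ≤ s * C := le_of_mul_le_mul_left h4 hs0
  linarith

/-- Lipschitz bound for the gradient on the contact set. -/
theorem ja_lip {g : Z → ℝ} {k : ℝ} (hk : 0 < k) {z₁ P₁ z₂ P₂ : Z}
    (hup₁ : ∀ y, g y ≤ g z₁ + ⟪P₁, y - z₁⟫ + k / 2 * ‖y - z₁‖ ^ 2)
    (hlo₁ : ∀ y, g z₁ + ⟪P₁, y - z₁⟫ ≤ g y)
    (hup₂ : ∀ y, g y ≤ g z₂ + ⟪P₂, y - z₂⟫ + k / 2 * ‖y - z₂‖ ^ 2) :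
    ‖P₁ - P₂‖ ≤ k * ‖z₁ - z₂‖ := by
  set h : Z := (1 / k) • (P₁ - P₂) with hh
  have a1 := hlo₁ (z₂ + h)
  have a2 := hup₂ (z₂ + h)
  have a3 := hup₁ z₂
  have e1 : z₂ + h - z₂ = h := by abel
  have e2 : z₂ + h - z₁ = (z₂ - z₁) + h := by abel
  rw [e1] at a2
  rw [e2, inner_add_right] at a1
  have e3 : ⟪P₁, h⟫ - ⟪P₂, h⟫ = 1 / k * ‖P₁ - P₂‖ ^ 2 := by
    rw [← inner_sub_left, hh, inner_smul_right, real_inner_self_eq_norm_sq]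
  have e4 : ‖h‖ ^ 2 = (1 / k) ^ 2 * ‖P₁ - P₂‖ ^ 2 := by
    rw [hh, norm_smul, mul_pow, Real.norm_of_nonneg (by positivity)]
  rw [e4] at a2
  have e5 : ‖z₂ - z₁‖ = ‖z₁ - z₂‖ := norm_sub_rev _ _
  rw [e5] at a3
  have key : 1 / k * ‖P₁ - P₂‖ ^ 2 ≤ k / 2 * ‖z₁ - z₂‖ ^ 2
      + k / 2 * ((1 / k) ^ 2 * ‖P₁ - P₂‖ ^ 2) := by linarith
  have e6 : k / 2 * ((1 / k) ^ 2 * ‖P₁ - P₂‖ ^ 2) = 1 / k * ‖P₁ - P₂‖ ^ 2 / 2 := by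
    field_simp
  rw [e6] at key
  have key2 : ‖P₁ - P₂‖ ^ 2 ≤ (k * ‖z₁ - z₂‖) ^ 2 := by
    have : 1 / k * ‖P₁ - P₂‖ ^ 2 ≤ k * ‖z₁ - z₂‖ ^ 2 := by linarith
    rw [div_mul_eq_mul_div, one_mul, div_le_iff₀ hk] at this
    nlinarith
  exact le_of_sq_le_sq key2 (by positivity)

/-- A point of density of `E` at which the Lipschitz field `P` is differentiable. -/
theorem ja_density [FiniteDimensional ℝ Z] {E : Set Z} {P p : Z → Z} {K K' : ℝ≥0} (hP : LipschitzOnWith K P E)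
    (hp : LipschitzOnWith K' p E) {r : ℝ} (hr : 0 < r) (hball : ball (0 : Z) r ⊆ p '' E) :
    ∃ z₁ ∈ E, ∃ B : Z →L[ℝ] Z,
      (∀ ε > 0, ∃ s > 0, ∀ z ∈ E, ‖z - z₁‖ ≤ s → ‖P z - P z₁ - B (z - z₁)‖ ≤ ε * ‖z - z₁‖) ∧
      (∀ η > 0, ∃ s > 0, ∀ h : Z, ‖h‖ ≤ s → ∃ ζ ∈ E, ‖ζ - (z₁ + h)‖ ≤ η * ‖h‖) := by
  borelize Z
  set μ : Measure Z := Measure.hausdorffMeasure (Module.finrank ℝ Z) with hμ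
  have : μ.IsAddHaarMeasure := MeasureTheory.isAddHaarMeasure_hausdorffMeasure
  have hE : μ E ≠ 0 := by
    intro h0
    have h1 := hp.hausdorffMeasure_image_le (d := (Module.finrank ℝ Z : ℝ)) (by positivity)
    have h2 : μ (p '' E) ≤ 0 := by
      refine h1.trans ?_
      rw [← hμ, h0, mul_zero]
    have h3 : 0 < μ (ball (0 : Z) r) := measure_ball_pos μ 0 hr
    exact absurd (h3.trans_le ((measure_mono hball).trans h2)) (lt_irrefl _)
  obtain ⟨G, hG, hGE⟩ := hP.extend_finite_dimension
  have A1 : ∀ᵐ x ∂(μ.restrict E), DifferentiableAt ℝ G x :=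
    ae_mono Measure.restrict_le_self (hG.ae_differentiableAt (μ := μ))
  have A2 : ∀ᵐ x ∂(μ.restrict E), ∀ n : ℕ,
      ∀ {ι : Type _} {l : Filter ι} (w : ι → Z) (δ : ι → ℝ) (_ : Tendsto δ l (nhdsWithin 0 (Ioi 0)))
      (_ : ∀ᶠ j in l, x ∈ closedBall (w j) ((n : ℝ) * δ j)),
      Tendsto (fun j => μ (E ∩ closedBall (w j) (δ j)) / μ (closedBall (w j) (δ j))) l (nhds 1) := by
    rw [ae_all_iff]
    intro n
    exact IsUnifLocDoublingMeasure.ae_tendsto_measure_inter_div μ E n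
  have A3 := (A1.and A2)
  obtain ⟨z₁, hz₁E, hd, hdens⟩ : ∃ z₁ ∈ E, DifferentiableAt ℝ G z₁ ∧ ∀ n : ℕ,
      ∀ {ι : Type _} {l : Filter ι} (w : ι → Z) (δ : ι → ℝ) (_ : Tendsto δ l (nhdsWithin 0 (Ioi 0)))
      (_ : ∀ᶠ j in l, z₁ ∈ closedBall (w j) ((n : ℝ) * δ j)),
      Tendsto (fun j => μ (E ∩ closedBall (w j) (δ j)) / μ (closedBall (w j) (δ j))) l (nhds 1) := by
    by_contra hcon
    apply hE
    rw [← Measure.restrict_apply_self]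
    refine measure_mono_null ?_ (ae_iff.1 A3)
    intro x hx
    simp only [mem_ofPred_eq]
    intro hx2
    exact hcon ⟨x, hx, hx2⟩
  refine ⟨z₁, hz₁E, fderiv ℝ G z₁, ?_, ?_⟩
  · intro ε hε
    have h1 := (hd.hasFDerivAt.isLittleO).def hε
    rw [Metric.eventually_nhds_iff] at h1
    obtain ⟨s, hs, h2⟩ := h1
    refine ⟨s / 2, by positivity, fun z hz hzs => ?_⟩
    have := h2 (y := z) (by rw [dist_eq_norm]; linarith)
    rwa [← hGE hz, ← hGE hz₁E] at this
  · intro η hη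
    obtain ⟨n, hn⟩ := exists_nat_gt (1 / η)
    have hnη : 1 ≤ n * η := by
      rw [div_lt_iff₀ hη] at hn; exact hn.le
    have ht := hdens n (l := nhdsWithin (0 : Z) {0}ᶜ) (fun h => z₁ + h) (fun h => η * ‖h‖) ?_ ?_
    · have h1 : ∀ᶠ h in nhdsWithin (0 : Z) {0}ᶜ,
        0 < μ (E ∩ closedBall (z₁ + h) (η * ‖h‖)) / μ (closedBall (z₁ + h) (η * ‖h‖)) :=
        ht.eventually (lt_mem_nhds zero_lt_one)
      rw [eventually_nhdsWithin_iff, Metric.eventually_nhds_iff] at h1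
      obtain ⟨s, hs, h2⟩ := h1
      refine ⟨s / 2, by positivity, fun h hh => ?_⟩
      by_cases h0 : h = 0
      · exact ⟨z₁, hz₁E, by simp [h0]⟩
      · have h3 := h2 (y := h) (by rw [dist_zero_right]; linarith) h0
        have h4 : μ (E ∩ closedBall (z₁ + h) (η * ‖h‖)) ≠ 0 := by
          intro h5; rw [h5] at h3; simp at h3
        obtain ⟨ζ, hζ1, hζ2⟩ := nonempty_of_measure_ne_zero h4
        exact ⟨ζ, hζ1, by rwa [mem_closedBall, dist_eq_norm] at hζ2⟩
    · rw [tendsto_nhdsWithin_iff]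
      constructor
      · have : Tendsto (fun h : Z => η * ‖h‖) (nhds 0) (nhds (η * ‖(0 : Z)‖)) :=
          (continuous_const.mul continuous_norm).tendsto 0
        rw [norm_zero, mul_zero] at this
        exact this.mono_left nhdsWithin_le_nhds
      · filter_upwards [self_mem_nhdsWithin] with h hh
        have : 0 < ‖h‖ := norm_pos_iff.2 hh
        exact mul_pos hη this
    · refine Eventually.of_forall fun h => ?_
      rw [mem_closedBall, dist_eq_norm]
      have : z₁ - (z₁ + h) = -h := by abel
      rw [this, norm_neg, ← mul_assoc]
      nlinarith [norm_nonneg h]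

/-- Second order Taylor expansion at a density point, by telescoping. -/
theorem ja_taylor {g : Z → ℝ} {E : Set Z} {P : Z → Z} {k : ℝ} (hk : 0 < k)
    (hup : ∀ z ∈ E, ∀ y, g y ≤ g z + ⟪P z, y - z⟫ + k / 2 * ‖y - z‖ ^ 2)
    (hlo : ∀ z ∈ E, ∀ y, g z + ⟪P z, y - z⟫ ≤ g y) {z₁ : Z} {B : Z →L[ℝ] Z}
    (h1 : ∀ ε > 0, ∃ s > 0, ∀ z ∈ E, ‖z - z₁‖ ≤ s →
      ‖P z - P z₁ - B (z - z₁)‖ ≤ ε * ‖z - z₁‖)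
    (h2 : ∀ η > 0, ∃ s > 0, ∀ h : Z, ‖h‖ ≤ s → ∃ ζ ∈ E, ‖ζ - (z₁ + h)‖ ≤ η * ‖h‖) :
    ∀ ε > 0, ∃ s > 0, ∀ h : Z, ‖h‖ ≤ s →
      |g (z₁ + h) - g z₁ - ⟪P z₁, h⟫ - 1 / 2 * ⟪B h, h⟫| ≤ ε * ‖h‖ ^ 2 := by
  intro ε hε
  obtain ⟨n, hn⟩ := exists_nat_gt (2 * ‖B‖ / ε)
  have hn0 : (0 : ℝ) < n := lt_of_le_of_lt (by positivity) hn
  have hnB : ‖B‖ / (2 * n) ≤ ε / 4 := by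
    rw [div_lt_iff₀ hε] at hn
    rw [div_le_iff₀ (by positivity)]
    linarith
  -- choice of η
  obtain ⟨η, hη0, hη1, hη2, hη3⟩ : ∃ η : ℝ, 0 < η ∧ η ≤ 1 ∧ ‖B‖ * η ≤ ε / 8 ∧
      n * (k / 2 * η ^ 2) ≤ ε / 4 := by
    refine ⟨min 1 (min (ε / (8 * (‖B‖ + 1))) (ε / (2 * n * k))), by positivity, min_le_left _ _,
      ?_, ?_⟩
    · have : min 1 (min (ε / (8 * (‖B‖ + 1))) (ε / (2 * n * k))) ≤ ε / (8 * (‖B‖ + 1)) :=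
        (min_le_right _ _).trans (min_le_left _ _)
      rw [le_div_iff₀ (by positivity)] at this
      have h0 : 0 < min 1 (min (ε / (8 * (‖B‖ + 1))) (ε / (2 * n * k))) := by positivity
      nlinarith [norm_nonneg B]
    · have : min 1 (min (ε / (8 * (‖B‖ + 1))) (ε / (2 * n * k))) ≤ ε / (2 * n * k) :=
        (min_le_right _ _).trans (min_le_right _ _)
      rw [le_div_iff₀ (by positivity)] at this
      have h0 : 0 < min 1 (min (ε / (8 * (‖B‖ + 1))) (ε / (2 * n * k))) := by positivity
      have h01 : min 1 (min (ε / (8 * (‖B‖ + 1))) (ε / (2 * n * k))) ≤ 1 := min_le_left _ _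
      have : (n * k) * min 1 (min (ε / (8 * (‖B‖ + 1))) (ε / (2 * n * k))) ^ 2 ≤
        (n * k) * min 1 (min (ε / (8 * (‖B‖ + 1))) (ε / (2 * n * k))) := by
        apply mul_le_mul_of_nonneg_left _ (by positivity)
        nlinarith
      nlinarith
  obtain ⟨s₁, hs₁, H1⟩ := h1 (ε / 16) (by positivity)
  obtain ⟨s₂, hs₂, H2⟩ := h2 η hη0
  refine ⟨min (s₁ / 2) s₂, by positivity, fun h hh => ?_⟩
  have hhs1 : 2 * ‖h‖ ≤ s₁ := by linarith [min_le_left (s₁ / 2) s₂]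
  have hhs2 : ‖h‖ ≤ s₂ := by linarith [min_le_right (s₁ / 2) s₂]
  set zz : ℕ → Z := fun j => z₁ + ((j : ℝ) / n) • h with hzz
  -- approximate points
  have hap : ∀ j : ℕ, j ≤ n → ∃ ζ ∈ E, ‖zz j - ζ‖ ≤ η * ‖h‖ ∧
      |⟪P ζ, h⟫ - ⟪P z₁, h⟫ - (j : ℝ) / n * ⟪B h, h⟫| ≤ ε / 4 * ‖h‖ ^ 2 := by
    intro j hj
    have hj1 : (j : ℝ) / n ≤ 1 := by
      rw [div_le_one hn0]; exact_mod_cast hj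
    have hj0 : 0 ≤ (j : ℝ) / n := by positivity
    have hnorm : ‖((j : ℝ) / n) • h‖ ≤ ‖h‖ := by
      rw [norm_smul, Real.norm_of_nonneg hj0]
      exact mul_le_of_le_one_left (norm_nonneg h) hj1
    obtain ⟨ζ, hζE, hζ⟩ := H2 (((j : ℝ) / n) • h) (hnorm.trans hhs2)
    have hζ' : ‖ζ - zz j‖ ≤ η * ‖h‖ := hζ.trans (mul_le_mul_of_nonneg_left hnorm hη0.le)
    refine ⟨ζ, hζE, by rwa [norm_sub_rev], ?_⟩
    have hd : ζ - z₁ = ((j : ℝ) / n) • h + (ζ - zz j) := by simp only [hzz]; abel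
    have hdn : ‖ζ - z₁‖ ≤ 2 * ‖h‖ := by
      rw [hd]
      refine (norm_add_le _ _).trans ?_
      nlinarith [norm_nonneg h]
    have h3 := H1 ζ hζE (hdn.trans hhs1)
    have h4 : ‖P ζ - P z₁ - ((j : ℝ) / n) • B h‖ ≤ ε / 4 * ‖h‖ := by
      have e : P ζ - P z₁ - ((j : ℝ) / n) • B h =
          (P ζ - P z₁ - B (ζ - z₁)) + B (ζ - zz j) := by
        rw [hd, map_add, map_smul]; abel
      rw [e]
      refine (norm_add_le _ _).trans ?_
      have h5 : ‖B (ζ - zz j)‖ ≤ ‖B‖ * (η * ‖h‖) :=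
        (B.le_opNorm _).trans (mul_le_mul_of_nonneg_left hζ' (norm_nonneg _))
      have h6 : ε / 16 * ‖ζ - z₁‖ ≤ ε / 16 * (2 * ‖h‖) :=
        mul_le_mul_of_nonneg_left hdn (by positivity)
      have h7 : ‖B‖ * (η * ‖h‖) ≤ ε / 8 * ‖h‖ := by
        rw [← mul_assoc]; exact mul_le_mul_of_nonneg_right hη2 (norm_nonneg _)
      linarith
    have e : ⟪P ζ, h⟫ - ⟪P z₁, h⟫ - (j : ℝ) / n * ⟪B h, h⟫ =
        ⟪P ζ - P z₁ - ((j : ℝ) / n) • B h, h⟫ := by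
      rw [inner_sub_left, inner_sub_left, inner_smul_left]; simp
    rw [e]
    refine (abs_real_inner_le_norm _ _).trans ?_
    nlinarith [norm_nonneg h]
  have hstep : ∀ j : ℕ, zz (j + 1) - zz j = (1 / (n : ℝ)) • h := by
    intro j
    simp only [hzz]
    push_cast
    have : z₁ + (((j : ℝ) + 1) / n) • h - (z₁ + ((j : ℝ) / n) • h) =
      ((((j : ℝ) + 1) / n) - ((j : ℝ) / n)) • h := by module
    rw [this]; congr 1; ring
  set p := ⟪P z₁, h⟫ with hpdef
  set b := ⟪B h, h⟫ with hbdef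
  set q := ‖h‖ ^ 2 with hqdef
  have hq0 : 0 ≤ q := by positivity
  set f := k / 2 * η ^ 2 * q with hf
  have herr : ∀ x : Z, ‖x‖ ≤ η * ‖h‖ → k / 2 * ‖x‖ ^ 2 ≤ f := by
    intro x hx
    have : ‖x‖ ^ 2 ≤ (η * ‖h‖) ^ 2 := pow_le_pow_left₀ (norm_nonneg _) hx 2
    rw [hf, hqdef]
    have := mul_le_mul_of_nonneg_left this (by positivity : 0 ≤ k / 2)
    nlinarith
  have lower : ∀ j : ℕ, j < n →
      (1 / (n : ℝ)) * (p + (j : ℝ) / n * b - ε / 4 * q) - f ≤ g (zz (j + 1)) - g (zz j) := by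
    intro j hj
    obtain ⟨ζ, hζE, hζ1, hζ2⟩ := hap j hj.le
    have a1 := hlo ζ hζE (zz (j + 1))
    have a2 := hup ζ hζE (zz j)
    have a3 := herr _ hζ1
    have e : zz (j + 1) - ζ = (zz j - ζ) + (1 / (n : ℝ)) • h := by rw [← hstep j]; abel
    rw [e, inner_add_right, inner_smul_right] at a1
    rw [abs_le] at hζ2
    have : (1 / (n : ℝ)) * (p + (j : ℝ) / n * b - ε / 4 * q) ≤ (1 / (n : ℝ)) * ⟪P ζ, h⟫ :=
      mul_le_mul_of_nonneg_left (by linarith [hζ2.1]) (by positivity)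
    linarith
  have upper : ∀ j : ℕ, j < n →
      g (zz (j + 1)) - g (zz j) ≤ (1 / (n : ℝ)) * (p + ((j : ℝ) + 1) / n * b + ε / 4 * q) + f := by
    intro j hj
    obtain ⟨ζ, hζE, hζ1, hζ2⟩ := hap (j + 1) hj
    have a1 := hlo ζ hζE (zz j)
    have a2 := hup ζ hζE (zz (j + 1))
    have a3 := herr _ hζ1
    have e : zz j - ζ = (zz (j + 1) - ζ) - (1 / (n : ℝ)) • h := by rw [← hstep j]; abel
    rw [e, inner_sub_right, inner_smul_right] at a1
    rw [abs_le] at hζ2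
    push_cast at hζ2
    have : (1 / (n : ℝ)) * ⟪P ζ, h⟫ ≤ (1 / (n : ℝ)) * (p + ((j : ℝ) + 1) / n * b + ε / 4 * q) :=
      mul_le_mul_of_nonneg_left (by linarith [hζ2.2]) (by positivity)
    linarith
  have sumlo : ∀ j : ℕ, j ≤ n → (j : ℝ) / n * p + (j : ℝ) * (j - 1) / (2 * n ^ 2) * b
      - (j : ℝ) / n * (ε / 4 * q) - j * f ≤ g (zz j) - g (zz 0) := by
    intro j
    induction j with
    | zero => intro _; simp
    | succ j ih =>
      intro hj
      have i1 := ih (by omega)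
      have i2 := lower j (by omega)
      have e : ((j + 1 : ℕ) : ℝ) / n * p + ((j + 1 : ℕ) : ℝ) * (((j + 1 : ℕ) : ℝ) - 1) / (2 * n ^ 2) * b
        - ((j + 1 : ℕ) : ℝ) / n * (ε / 4 * q) - ((j + 1 : ℕ) : ℝ) * f =
        ((j : ℝ) / n * p + (j : ℝ) * (j - 1) / (2 * n ^ 2) * b
          - (j : ℝ) / n * (ε / 4 * q) - j * f) +
        ((1 / (n : ℝ)) * (p + (j : ℝ) / n * b - ε / 4 * q) - f) := by
        push_cast; field_simp; ring
      rw [e]; linarith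
  have sumup : ∀ j : ℕ, j ≤ n → g (zz j) - g (zz 0) ≤
      (j : ℝ) / n * p + (j : ℝ) * (j + 1) / (2 * n ^ 2) * b
      + (j : ℝ) / n * (ε / 4 * q) + j * f := by
    intro j
    induction j with
    | zero => intro _; simp
    | succ j ih =>
      intro hj
      have i1 := ih (by omega)
      have i2 := upper j (by omega)
      have e : ((j + 1 : ℕ) : ℝ) / n * p + ((j + 1 : ℕ) : ℝ) * (((j + 1 : ℕ) : ℝ) + 1) / (2 * n ^ 2) * b
        + ((j + 1 : ℕ) : ℝ) / n * (ε / 4 * q) + ((j + 1 : ℕ) : ℝ) * f =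
        ((j : ℝ) / n * p + (j : ℝ) * (j + 1) / (2 * n ^ 2) * b
          + (j : ℝ) / n * (ε / 4 * q) + j * f) +
        ((1 / (n : ℝ)) * (p + ((j : ℝ) + 1) / n * b + ε / 4 * q) + f) := by
        push_cast; field_simp; ring
      rw [e]; linarith
  have z0 : zz 0 = z₁ := by simp [hzz]
  have zn : zz n = z₁ + h := by simp [hzz, div_self hn0.ne']
  have l1 := sumlo n le_rfl
  have l2 := sumup n le_rfl
  rw [z0, zn, div_self hn0.ne'] at l1 l2
  have hbB : |b| ≤ ‖B‖ * q := by
    rw [hbdef, hqdef]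
    refine (abs_real_inner_le_norm _ _).trans ?_
    have := mul_le_mul_of_nonneg_right (B.le_opNorm h) (norm_nonneg h)
    linarith [this, (by ring : ‖B‖ * ‖h‖ * ‖h‖ = ‖B‖ * ‖h‖ ^ 2)]
  have hb2 : |b / (2 * n)| ≤ ε / 4 * q := by
    rw [abs_div, abs_of_pos (by positivity : (0 : ℝ) < 2 * n)]
    calc |b| / (2 * n) ≤ ‖B‖ * q / (2 * n) := div_le_div_of_nonneg_right hbB (by positivity)
      _ = ‖B‖ / (2 * n) * q := by ring
      _ ≤ ε / 4 * q := mul_le_mul_of_nonneg_right hnB hq0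
  rw [abs_le] at hb2
  have hfn : n * f ≤ ε / 4 * q := by
    rw [hf, ← mul_assoc]; exact mul_le_mul_of_nonneg_right hη3 hq0
  have e1 : (n : ℝ) * (n - 1) / (2 * n ^ 2) * b = 1 / 2 * b - b / (2 * n) := by field_simp
  have e2 : (n : ℝ) * (n + 1) / (2 * n ^ 2) * b = 1 / 2 * b + b / (2 * n) := by field_simp
  rw [e1] at l1
  rw [e2] at l2
  rw [abs_le]
  have : 0 ≤ ε * q := by positivity
  constructor <;> linarith [hb2.1, hb2.2]

/-- Jensen's lemma combined with Alexandrov's theorem: near a strict maximum point of a semiconvex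
function there is a point of second order differentiability which is a maximum up to a small
linear perturbation. -/
theorem jensen_alexandrov [FiniteDimensional ℝ Z] {f : Z → ℝ} {k : ℝ} (hk : 0 < k)
    (hconv : ConvexOn ℝ univ (fun z => f z + k / 2 * ‖z‖ ^ 2)) {z₀ : Z} {μ : ℝ} (hμ : 0 < μ)
    (hmax : ∀ z, f z ≤ f z₀ - μ * ‖z - z₀‖ ^ 2) :
    ∀ ρ > 0, ∃ z₁ p : Z, ∃ B : Z →L[ℝ] Z, ‖z₁ - z₀‖ ≤ ρ ∧ ‖p‖ ≤ ρ ∧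
      (∀ z, f z ≤ f z₁ + ⟪p, z - z₁⟫) ∧
      ∀ ε > 0, ∃ s > 0, ∀ h : Z, ‖h‖ ≤ s →
        |f (z₁ + h) - f z₁ - ⟪p, h⟫ - 1 / 2 * ⟪B h, h⟫| ≤ ε * ‖h‖ ^ 2 := by
  classical
  intro ρ hρ
  set r := min ρ (ρ * μ) with hr
  have hr0 : 0 < r := by positivity
  set g : Z → ℝ := fun z => f z + k / 2 * ‖z‖ ^ 2 with hg
  have hgc : Continuous g := by
    rw [← continuousOn_univ]
    exact hconv.continuousOn isOpen_univ
  have hfc : Continuous f := by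
    have : f = fun z => g z - k / 2 * ‖z‖ ^ 2 := by funext z; simp [hg]
    rw [this]; fun_prop
  set E : Set Z := {z | ∃ p ∈ ball (0 : Z) r, ∀ y, f y ≤ f z + ⟪p, y - z⟫} with hE
  have hEz : ∀ z ∈ E, ‖z - z₀‖ ≤ ρ := by
    rintro z ⟨p, hp, hy⟩
    have a1 := hy z₀
    have a2 := hmax z
    have a3 : ⟪p, z₀ - z⟫ ≤ ‖p‖ * ‖z - z₀‖ := by
      rw [norm_sub_rev z z₀]; exact real_inner_le_norm _ _
    have a4 : ‖p‖ ≤ ρ * μ := by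
      rw [mem_ball_zero_iff] at hp
      exact hp.le.trans (min_le_right _ _)
    by_contra hcon
    push Not at hcon
    have hpos : 0 < ‖z - z₀‖ := hρ.trans hcon
    have : μ * ‖z - z₀‖ ^ 2 ≤ ρ * μ * ‖z - z₀‖ := by nlinarith
    have h5 : μ * ρ * ‖z - z₀‖ < μ * ‖z - z₀‖ * ‖z - z₀‖ := by
      apply mul_lt_mul_of_pos_right _ hpos
      exact mul_lt_mul_of_pos_left hcon hμ
    nlinarith
  have hEx : ∀ p ∈ ball (0 : Z) r, ∃ z, ∀ y, f y ≤ f z + ⟪p, y - z⟫ := by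
    intro p hp
    have hc : ContinuousOn (fun z => f z - ⟪p, z⟫) (closedBall z₀ ρ) := by fun_prop
    obtain ⟨z, hz, hzm⟩ := (isCompact_closedBall z₀ ρ).exists_isMaxOn
      ⟨z₀, mem_closedBall_self hρ.le⟩ hc
    refine ⟨z, fun y => ?_⟩
    rw [inner_sub_right]
    by_cases hy : y ∈ closedBall z₀ ρ
    · have : f y - ⟪p, y⟫ ≤ f z - ⟪p, z⟫ := hzm hy
      linarith
    · have h0 : f z₀ - ⟪p, z₀⟫ ≤ f z - ⟪p, z⟫ := hzm (mem_closedBall_self hρ.le)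
      have h1 := hmax y
      rw [mem_closedBall, dist_eq_norm] at hy
      push Not at hy
      have a3 : -(‖p‖ * ‖y - z₀‖) ≤ ⟪p, y - z₀⟫ :=
        (abs_le.1 (abs_real_inner_le_norm _ _)).1
      have a4 : ‖p‖ ≤ ρ * μ := by
        rw [mem_ball_zero_iff] at hp
        exact hp.le.trans (min_le_right _ _)
      rw [inner_sub_right] at a3
      have hpos : 0 < ‖y - z₀‖ := hρ.trans hy
      have h5 : μ * ρ * ‖y - z₀‖ < μ * ‖y - z₀‖ * ‖y - z₀‖ := by
        apply mul_lt_mul_of_pos_right _ hpos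
        exact mul_lt_mul_of_pos_left hy hμ
      have : ‖p‖ * ‖y - z₀‖ ≤ ρ * μ * ‖y - z₀‖ := mul_le_mul_of_nonneg_right a4 hpos.le
      nlinarith
  -- the gradient field
  set pf : Z → Z := fun z => if h : z ∈ E then Classical.choose h else 0 with hpf
  have hpf1 : ∀ z ∈ E, pf z ∈ ball (0 : Z) r ∧ ∀ y, f y ≤ f z + ⟪pf z, y - z⟫ := by
    intro z hz
    have : pf z = Classical.choose hz := by simp only [hpf]; rw [dif_pos hz]
    rw [this]
    exact Classical.choose_spec hz
  have conv_up : ∀ z p : Z, (∀ y, f y ≤ f z + ⟪p, y - z⟫) →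
      ∀ y, g y ≤ g z + ⟪p + k • z, y - z⟫ + k / 2 * ‖y - z‖ ^ 2 := by
    intro z p h y
    have h1 := h y
    have e : ‖y‖ ^ 2 = ‖z‖ ^ 2 + 2 * ⟪z, y - z⟫ + ‖y - z‖ ^ 2 := by
      have : y = z + (y - z) := by abel
      conv_lhs => rw [this]
      exact norm_add_sq_real z (y - z)
    simp only [hg]
    rw [inner_add_left, inner_smul_left, e]
    simp only [conj_trivial]
    linarith
  have key : ∀ z₁ p₁ z₂ p₂ : Z, (∀ y, f y ≤ f z₁ + ⟪p₁, y - z₁⟫) →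
      (∀ y, f y ≤ f z₂ + ⟪p₂, y - z₂⟫) →
      ‖(p₁ + k • z₁) - (p₂ + k • z₂)‖ ≤ k * ‖z₁ - z₂‖ := by
    intro z₁ p₁ z₂ p₂ h₁ h₂
    exact ja_lip hk (conv_up _ _ h₁) (ja_lower hconv hk.le (conv_up _ _ h₁)) (conv_up _ _ h₂)
  set P : Z → Z := fun z => pf z + k • z with hP
  have hPL : LipschitzOnWith (Real.toNNReal k) P E := by
    apply LipschitzOnWith.of_dist_le_mul
    intro x hx y hy
    rw [dist_eq_norm, dist_eq_norm, Real.coe_toNNReal k hk.le]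
    exact key _ _ _ _ (hpf1 x hx).2 (hpf1 y hy).2
  have hpL : LipschitzOnWith (Real.toNNReal (2 * k)) pf E := by
    apply LipschitzOnWith.of_dist_le_mul
    intro x hx y hy
    rw [dist_eq_norm, dist_eq_norm, Real.coe_toNNReal (2 * k) (by positivity)]
    have h1 := key _ _ _ _ (hpf1 x hx).2 (hpf1 y hy).2
    have e : pf x - pf y = ((pf x + k • x) - (pf y + k • y)) - k • (x - y) := by
      rw [smul_sub]; abel
    rw [e]
    refine (norm_sub_le _ _).trans ?_
    rw [norm_smul, Real.norm_of_nonneg hk.le]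
    linarith
  have hball : ball (0 : Z) r ⊆ pf '' E := by
    intro p hp
    obtain ⟨z, hz⟩ := hEx p hp
    have hzE : z ∈ E := ⟨p, hp, hz⟩
    refine ⟨z, hzE, ?_⟩
    have h1 := key _ _ _ _ (hpf1 z hzE).2 hz
    rw [sub_self, norm_zero, mul_zero] at h1
    have h2 := norm_le_zero_iff.1 h1
    have e : pf z + k • z - (p + k • z) = pf z - p := by abel
    rw [e] at h2
    exact sub_eq_zero.1 h2
  obtain ⟨z₁, hz₁, B, hB1, hB2⟩ := ja_density hPL hpL hr0 hball
  have hT := ja_taylor hk (fun z hz => conv_up z _ (hpf1 z hz).2)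
    (fun z hz => ja_lower hconv hk.le (conv_up z _ (hpf1 z hz).2)) hB1 hB2
  refine ⟨z₁, pf z₁, B - k • ContinuousLinearMap.id ℝ Z, hEz z₁ hz₁, ?_, (hpf1 z₁ hz₁).2, ?_⟩
  · have := (hpf1 z₁ hz₁).1
    rw [mem_ball_zero_iff] at this
    exact this.le.trans (min_le_left _ _)
  · intro ε hε
    obtain ⟨s, hs, h1⟩ := hT ε hε
    refine ⟨s, hs, fun h hh => ?_⟩
    have h2 := h1 h hh
    convert h2 using 2
    simp only [hg]
    simp only [inner_sub_left, inner_add_left, inner_smul_left, sub_apply,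
      smul_apply, ContinuousLinearMap.id_apply, conj_trivial,
      real_inner_self_eq_norm_sq]
    rw [norm_add_sq_real]
    ring

end JensenAlexandrov

end Part1

section Part2

/-! ### Part 2: the theorem on sums -/

section Sums

variable {E : Type*} [NormedAddCommGroup E] [InnerProductSpace ℝ E]

/-- Sup-convolution on a compact set. -/
theorem supconv_exists {K : Set E} (hK : IsCompact K) (hne : K.Nonempty) {u : E → ℝ}
    (hu : UpperSemicontinuousOn u K) (δ : ℝ) :
    ∃ V : E → ℝ, ∃ π : E → E, (∀ z, π z ∈ K ∧ V z = u (π z) - ‖π z - z‖ ^ 2 / (2 * δ)) ∧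
      ∀ z, ∀ ζ ∈ K, u ζ - ‖ζ - z‖ ^ 2 / (2 * δ) ≤ V z := by
  have key : ∀ z : E, ∃ ζ ∈ K, ∀ ζ' ∈ K, u ζ' - ‖ζ' - z‖ ^ 2 / (2 * δ) ≤
      u ζ - ‖ζ - z‖ ^ 2 / (2 * δ) := by
    intro z
    have h1 : UpperSemicontinuousOn (fun ζ => u ζ + -(‖ζ - z‖ ^ 2 / (2 * δ))) K := by
      apply hu.add
      apply ContinuousOn.upperSemicontinuousOn
      fun_prop
    obtain ⟨ζ, hζ, hmax⟩ := h1.exists_isMaxOn hne hK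
    refine ⟨ζ, hζ, fun ζ' hζ' => ?_⟩
    have := hmax hζ'
    simp only [mem_ofPred_eq] at this
    linarith
  choose π hπ hmax using key
  exact ⟨fun z => u (π z) - ‖π z - z‖ ^ 2 / (2 * δ), π, fun z => ⟨hπ z, rfl⟩, fun z ζ hζ => hmax z ζ hζ⟩

theorem supconv_convex {K : Set E} {u : E → ℝ} {δ : ℝ} (hδ : 0 < δ)
    {V : E → ℝ} {π : E → E} (h1 : ∀ z, π z ∈ K ∧ V z = u (π z) - ‖π z - z‖ ^ 2 / (2 * δ))
    (h2 : ∀ z, ∀ ζ ∈ K, u ζ - ‖ζ - z‖ ^ 2 / (2 * δ) ≤ V z) :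
    ConvexOn ℝ univ (fun z => V z + ‖z‖ ^ 2 / (2 * δ)) := by
  refine ⟨convex_univ, ?_⟩
  intro x _ y _ a b ha hb hab
  simp only [smul_eq_mul]
  obtain ⟨hζ, hV⟩ := h1 (a • x + b • y)
  set ζ := π (a • x + b • y) with hζdef
  have hx := h2 x ζ hζ
  have hy := h2 y ζ hζ
  have e : ∀ z : E, -(‖ζ - z‖ ^ 2 / (2 * δ)) + ‖z‖ ^ 2 / (2 * δ) = -(‖ζ‖ ^ 2 / (2 * δ)) + ⟪ζ, z⟫ / δ := by
    intro z
    rw [norm_sub_sq_real]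
    field_simp
    ring
  have ex := e x
  have ey := e y
  have ez := e (a • x + b • y)
  rw [inner_add_right, inner_smul_right, inner_smul_right] at ez
  rw [hV]
  have hx' : u ζ + (-(‖ζ‖ ^ 2 / (2 * δ)) + ⟪ζ, x⟫ / δ) ≤ V x + ‖x‖ ^ 2 / (2 * δ) := by
    rw [← ex]; linarith
  have hy' : u ζ + (-(‖ζ‖ ^ 2 / (2 * δ)) + ⟪ζ, y⟫ / δ) ≤ V y + ‖y‖ ^ 2 / (2 * δ) := by
    rw [← ey]; linarith
  have hx2 := mul_le_mul_of_nonneg_left hx' ha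
  have hy2 := mul_le_mul_of_nonneg_left hy' hb
  have hz : u ζ - ‖ζ - (a • x + b • y)‖ ^ 2 / (2 * δ) + ‖a • x + b • y‖ ^ 2 / (2 * δ)
     = u ζ + (-(‖ζ‖ ^ 2 / (2 * δ)) + (a * ⟪ζ, x⟫ + b * ⟪ζ, y⟫) / δ) := by
    rw [← ez]; ring
  rw [hz]
  obtain rfl : b = 1 - a := by linarith
  calc u ζ + (-(‖ζ‖ ^ 2 / (2 * δ)) + (a * ⟪ζ, x⟫ + (1 - a) * ⟪ζ, y⟫) / δ)
      = a * (u ζ + (-(‖ζ‖ ^ 2 / (2 * δ)) + ⟪ζ, x⟫ / δ)) + (1 - a) * (u ζ + (-(‖ζ‖ ^ 2 / (2 * δ)) + ⟪ζ, y⟫ / δ)) := by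
        ring
    _ ≤ _ := by linarith

set_option maxHeartbeats 1600000 in
/-- Jensen's lemma for the doubled function. -/
theorem jensen_pair [FiniteDimensional ℝ E] {V W : E → ℝ} {δ : ℝ} (hδ : 0 < δ)
    (hV : ConvexOn ℝ univ (fun z => V z + ‖z‖ ^ 2 / (2 * δ)))
    (hW : ConvexOn ℝ univ (fun z => W z + ‖z‖ ^ 2 / (2 * δ)))
    {z₀ z₀' : E} (hmax : ∀ z z', V z + W z' - ‖z - z'‖ ^ 2 / (2 * δ) ≤
      V z₀ + W z₀' - ‖z₀ - z₀'‖ ^ 2 / (2 * δ)) {ρ : ℝ} (hρ : 0 < ρ) :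
    ∃ z₁ z₁' P Q : E, ∃ X Y : E →L[ℝ] E,
      V z₀ + W z₀' - ‖z₀ - z₀'‖ ^ 2 / (2 * δ) ≤ V z₁ + W z₁' - ‖z₁ - z₁'‖ ^ 2 / (2 * δ) + ρ ∧
      ‖P - (1 / δ) • (z₀ - z₀')‖ ≤ ρ ∧ ‖Q + (1 / δ) • (z₀ - z₀')‖ ≤ ρ ∧
      (∀ h h' : E, ⟪X h, h⟫ + ⟪Y h', h'⟫ ≤ ‖h - h'‖ ^ 2 / δ + ρ * (‖h‖ ^ 2 + ‖h'‖ ^ 2)) ∧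
      (∃ s > 0, ∀ h, ‖h‖ ≤ s → V (z₁ + h) ≤ V z₁ + ⟪P, h⟫ + 1 / 2 * ⟪X h, h⟫) ∧
      (∃ s > 0, ∀ h, ‖h‖ ≤ s → W (z₁' + h) ≤ W z₁' + ⟪Q, h⟫ + 1 / 2 * ⟪Y h, h⟫) := by
  have winner : ∀ a b : WithLp 2 (E × E), ⟪a, b⟫ = ⟪a.fst, b.fst⟫ + ⟪a.snd, b.snd⟫ :=
    fun a b => WithLp.prod_inner_apply a b
  set μ := ρ / 8 with hμdef
  have hμ : 0 < μ := by positivity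
  set Z₀ : WithLp 2 (E × E) := WithLp.toLp 2 (z₀, z₀') with hZ₀
  set f : WithLp 2 (E × E) → ℝ := fun Z => V Z.fst + W Z.snd - ‖Z.fst - Z.snd‖ ^ 2 / (2 * δ)
    - μ * ‖Z - Z₀‖ ^ 2 with hf
  have hnormsub : ∀ Z : WithLp 2 (E × E), ‖Z - Z₀‖ ^ 2 = ‖Z.fst - z₀‖ ^ 2 + ‖Z.snd - z₀'‖ ^ 2 := by
    intro Z
    rw [WithLp.prod_norm_sq_eq_of_L2]
    simp [hZ₀]
  have hfmax : ∀ Z, f Z ≤ f Z₀ - μ * ‖Z - Z₀‖ ^ 2 := by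
    intro Z
    have := hmax Z.fst Z.snd
    simp only [hf, sub_self, norm_zero]
    simp only [hZ₀, WithLp.toLp_fst, WithLp.toLp_snd] at this ⊢
    linarith
  set k := 3 / δ + 2 * μ with hkdef
  have hk : 0 < k := by positivity
  have hconv : ConvexOn ℝ univ (fun Z => f Z + k / 2 * ‖Z‖ ^ 2) := by
    have e : (fun Z => f Z + k / 2 * ‖Z‖ ^ 2) = fun Z : WithLp 2 (E × E) =>
        (V Z.fst + ‖Z.fst‖ ^ 2 / (2 * δ)) + (W Z.snd + ‖Z.snd‖ ^ 2 / (2 * δ))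
        + (1 / (2 * δ)) * ‖Z.fst + Z.snd‖ ^ 2 + (2 * μ) * ⟪Z₀, Z⟫ + -(μ * ‖Z₀‖ ^ 2) := by
      funext Z
      simp only [hf, hkdef]
      rw [norm_sub_sq_real Z Z₀, norm_sub_sq_real, norm_add_sq_real, WithLp.prod_norm_sq_eq_of_L2 Z,
        real_inner_comm Z Z₀]
      field_simp
      ring
    rw [e]
    have c1 : ConvexOn ℝ univ (fun Z : WithLp 2 (E × E) => V Z.fst + ‖Z.fst‖ ^ 2 / (2 * δ)) :=
      hV.comp_linearMap (WithLp.fstₗ 2 ℝ E E)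
    have c2 : ConvexOn ℝ univ (fun Z : WithLp 2 (E × E) => W Z.snd + ‖Z.snd‖ ^ 2 / (2 * δ)) :=
      hW.comp_linearMap (WithLp.sndₗ 2 ℝ E E)
    have cn : ConvexOn ℝ univ (fun z : E => ‖z‖ ^ 2) :=
      (convexOn_univ_norm (E := E)).pow (fun _ _ => norm_nonneg _) 2
    have c3 : ConvexOn ℝ univ (fun Z : WithLp 2 (E × E) => (1 / (2 * δ)) * ‖Z.fst + Z.snd‖ ^ 2) :=
      (cn.comp_linearMap (WithLp.fstₗ 2 ℝ E E + WithLp.sndₗ 2 ℝ E E)).smul (c := 1 / (2 * δ)) (by positivity)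
    have c4 : ConvexOn ℝ univ (fun Z : WithLp 2 (E × E) => (2 * μ) * ⟪Z₀, Z⟫) :=
      ((innerₛₗ ℝ Z₀).convexOn convex_univ).smul (c := 2 * μ) (by positivity)
    exact (((c1.add c2).add c3).add c4).add (convexOn_const _ convex_univ)
  set ρ' := min 1 ρ / (1 + 2 / δ + 2 * μ) with hρ'def
  have hden : 1 ≤ 1 + 2 / δ + 2 * μ := by
    have : 0 < 2 / δ := by positivity
    linarith
  have hmin : 0 < min 1 ρ := lt_min one_pos hρ
  have hρ' : 0 < ρ' := by positivity
  have hρ'm : ρ' * (1 + 2 / δ + 2 * μ) = min 1 ρ := by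
    rw [hρ'def]; field_simp
  have hρ'1 : ρ' ≤ min 1 ρ := by nlinarith
  have hρ'a : ρ' ≤ 1 := hρ'1.trans (min_le_left _ _)
  have hρ'b : ρ' ≤ ρ := hρ'1.trans (min_le_right _ _)
  obtain ⟨Z₁, p, B, hZ₁, hp, htouch, hexp⟩ := jensen_alexandrov hk hconv hμ hfmax ρ' hρ'
  have hfstle : ∀ Z : WithLp 2 (E × E), ‖Z.fst‖ ≤ ‖Z‖ := by
    intro Z
    have := WithLp.prod_norm_sq_eq_of_L2 Z
    nlinarith [norm_nonneg Z, norm_nonneg Z.fst, norm_nonneg Z.snd, sq_nonneg ‖Z.snd‖]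
  have hsndle : ∀ Z : WithLp 2 (E × E), ‖Z.snd‖ ≤ ‖Z‖ := by
    intro Z
    have := WithLp.prod_norm_sq_eq_of_L2 Z
    nlinarith [norm_nonneg Z, norm_nonneg Z.fst, norm_nonneg Z.snd, sq_nonneg ‖Z.fst‖]
  set z₁ := Z₁.fst with hz₁
  set z₁' := Z₁.snd with hz₁'
  have hd1 : ‖z₁ - z₀‖ ≤ ρ' := by
    have := hfstle (Z₁ - Z₀)
    simp only [WithLp.sub_fst, hZ₀, WithLp.toLp_fst] at this
    exact this.trans hZ₁
  have hd2 : ‖z₁' - z₀'‖ ≤ ρ' := by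
    have := hsndle (Z₁ - Z₀)
    simp only [WithLp.sub_snd, hZ₀, WithLp.toLp_snd] at this
    exact this.trans hZ₁
  obtain ⟨s, hs, hexp⟩ := hexp μ hμ
  set inl : E →L[ℝ] WithLp 2 (E × E) :=
    ((WithLp.prodContinuousLinearEquiv 2 ℝ E E).symm : E × E →L[ℝ] WithLp 2 (E × E)).comp
      (ContinuousLinearMap.inl ℝ E E) with hinl
  set inr : E →L[ℝ] WithLp 2 (E × E) :=
    ((WithLp.prodContinuousLinearEquiv 2 ℝ E E).symm : E × E →L[ℝ] WithLp 2 (E × E)).comp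
      (ContinuousLinearMap.inr ℝ E E) with hinr
  have inlf : ∀ h, (inl h).fst = h := fun h => rfl
  have inls : ∀ h, (inl h).snd = 0 := fun h => rfl
  have inrf : ∀ h, (inr h).fst = 0 := fun h => rfl
  have inrs : ∀ h, (inr h).snd = h := fun h => rfl
  have inln : ∀ h, ‖inl h‖ = ‖h‖ := by
    intro h
    have := WithLp.prod_norm_sq_eq_of_L2 (inl h)
    rw [inlf, inls, norm_zero] at this
    nlinarith [norm_nonneg (inl h), norm_nonneg h, sq_nonneg (‖inl h‖ - ‖h‖),
      abs_eq_abs.1 (by rw [← sq_eq_sq_iff_abs_eq_abs]; linarith : |‖inl h‖| = |‖h‖|) |>.elim id (fun q => by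
        linarith [norm_nonneg (inl h), norm_nonneg h])]
  have inrn : ∀ h, ‖inr h‖ = ‖h‖ := by
    intro h
    have := WithLp.prod_norm_sq_eq_of_L2 (inr h)
    rw [inrf, inrs, norm_zero] at this
    nlinarith [norm_nonneg (inr h), norm_nonneg h, sq_nonneg (‖inr h‖ - ‖h‖),
      abs_eq_abs.1 (by rw [← sq_eq_sq_iff_abs_eq_abs]; linarith : |‖inr h‖| = |‖h‖|) |>.elim id (fun q => by
        linarith [norm_nonneg (inr h), norm_nonneg h])]
  set P : E := p.fst + (1 / δ) • (z₁ - z₁') + (2 * μ) • (z₁ - z₀) with hP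
  set Q : E := p.snd - (1 / δ) • (z₁ - z₁') + (2 * μ) • (z₁' - z₀') with hQ
  set X0 : E →L[ℝ] E := (WithLp.fstL 2 ℝ E E).comp (B.comp inl) + (1 / δ + 2 * μ) • ContinuousLinearMap.id ℝ E with hX0
  set Y0 : E →L[ℝ] E := (WithLp.sndL 2 ℝ E E).comp (B.comp inr) + (1 / δ + 2 * μ) • ContinuousLinearMap.id ℝ E with hY0
  have hX0q : ∀ h, ⟪X0 h, h⟫ = ⟪B (inl h), inl h⟫ + (1 / δ + 2 * μ) * ‖h‖ ^ 2 := by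
    intro h
    have : X0 h = (B (inl h)).fst + (1 / δ + 2 * μ) • h := rfl
    rw [this, inner_add_left, inner_smul_left, real_inner_self_eq_norm_sq, winner, inlf, inls]
    simp
  have hY0q : ∀ h, ⟪Y0 h, h⟫ = ⟪B (inr h), inr h⟫ + (1 / δ + 2 * μ) * ‖h‖ ^ 2 := by
    intro h
    have : Y0 h = (B (inr h)).snd + (1 / δ + 2 * μ) • h := rfl
    rw [this, inner_add_left, inner_smul_left, real_inner_self_eq_norm_sq, winner, inrf, inrs]
    simp
  -- value of f at a shifted point
  have hfval : ∀ h h' : E, ∀ Hh : WithLp 2 (E × E), Hh.fst = h → Hh.snd = h' →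
      f (Z₁ + Hh) - f Z₁ = (V (z₁ + h) - V z₁) + (W (z₁' + h') - W z₁') - ⟪z₁ - z₁', h - h'⟫ / δ
        - ‖h - h'‖ ^ 2 / (2 * δ) - 2 * μ * (⟪z₁ - z₀, h⟫ + ⟪z₁' - z₀', h'⟫) - μ * (‖h‖ ^ 2 + ‖h'‖ ^ 2) := by
    intro h h' Hh e1 e2
    simp only [hf, hnormsub, WithLp.add_fst, WithLp.add_snd, e1, e2, ← hz₁, ← hz₁']
    have a1 : z₁ + h - (z₁' + h') = (z₁ - z₁') + (h - h') := by abel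
    have a2 : z₁ + h - z₀ = (z₁ - z₀) + h := by abel
    have a3 : z₁' + h' - z₀' = (z₁' - z₀') + h' := by abel
    rw [a1, a2, a3, norm_add_sq_real, norm_add_sq_real, norm_add_sq_real]
    field_simp
    ring
  have hVexp : ∀ h, ‖h‖ ≤ s → |V (z₁ + h) - V z₁ - ⟪P, h⟫ - 1 / 2 * ⟪X0 h, h⟫| ≤ μ * ‖h‖ ^ 2 := by
    intro h hh
    have h1 := hexp (inl h) (by rw [inln]; exact hh)
    have h2 := hfval h 0 (inl h) (inlf h) (inls h)
    rw [inln] at h1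
    have h3 : V (z₁ + h) - V z₁ - ⟪P, h⟫ - 1 / 2 * ⟪X0 h, h⟫
       = f (Z₁ + inl h) - f Z₁ - ⟪p, inl h⟫ - 1 / 2 * ⟪B (inl h), inl h⟫ := by
      rw [h2, hX0q, hP, inner_add_left, inner_add_left, inner_smul_left, inner_smul_left,
        winner p, inlf, inls]
      simp
      field_simp
      ring
    rw [h3]
    exact h1
  have hWexp : ∀ h, ‖h‖ ≤ s → |W (z₁' + h) - W z₁' - ⟪Q, h⟫ - 1 / 2 * ⟪Y0 h, h⟫| ≤ μ * ‖h‖ ^ 2 := by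
    intro h hh
    have h1 := hexp (inr h) (by rw [inrn]; exact hh)
    have h2 := hfval 0 h (inr h) (inrf h) (inrs h)
    rw [inrn] at h1
    have h3 : W (z₁' + h) - W z₁' - ⟪Q, h⟫ - 1 / 2 * ⟪Y0 h, h⟫
       = f (Z₁ + inr h) - f Z₁ - ⟪p, inr h⟫ - 1 / 2 * ⟪B (inr h), inr h⟫ := by
      rw [h2, hY0q, hQ, inner_add_left, inner_sub_left, inner_smul_left, inner_smul_left,
        winner p, inrf, inrs]
      simp
      field_simp
      ring
    rw [h3]
    exact h1
  have hcore : ∀ h h' : E, ‖h‖ ≤ s → ‖h'‖ ≤ s → ⟪X0 h, h⟫ + ⟪Y0 h', h'⟫ ≤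
      ‖h - h'‖ ^ 2 / δ + 4 * μ * (‖h‖ ^ 2 + ‖h'‖ ^ 2) := by
    intro h h' hh hh'
    have h1 := (abs_le.1 (hVexp h hh)).1
    have h2 := (abs_le.1 (hWexp h' hh')).1
    have h3 := htouch (Z₁ + (inl h + inr h'))
    have h4 := hfval h h' (inl h + inr h') (by rw [WithLp.add_fst, inlf, inrf, add_zero])
      (by rw [WithLp.add_snd, inls, inrs, zero_add])
    rw [add_sub_cancel_left, winner] at h3
    have e1 : (inl h + inr h').fst = h := by rw [WithLp.add_fst, inlf, inrf, add_zero]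
    have e2 : (inl h + inr h').snd = h' := by rw [WithLp.add_snd, inls, inrs, zero_add]
    rw [e1, e2] at h3
    have eP : ⟪P, h⟫ = ⟪p.fst, h⟫ + ⟪z₁ - z₁', h⟫ / δ + 2 * μ * ⟪z₁ - z₀, h⟫ := by
      rw [hP, inner_add_left, inner_add_left, inner_smul_left, inner_smul_left]
      simp
      ring
    have eQ : ⟪Q, h'⟫ = ⟪p.snd, h'⟫ - ⟪z₁ - z₁', h'⟫ / δ + 2 * μ * ⟪z₁' - z₀', h'⟫ := by
      rw [hQ, inner_add_left, inner_sub_left, inner_smul_left, inner_smul_left]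
      simp
      ring
    rw [inner_sub_right] at h4
    have e5 : ‖h - h'‖ ^ 2 / (2 * δ) = (‖h - h'‖ ^ 2 / δ) / 2 := by field_simp
    have e6 : (⟪z₁ - z₁', h⟫ - ⟪z₁ - z₁', h'⟫) / δ = ⟪z₁ - z₁', h⟫ / δ - ⟪z₁ - z₁', h'⟫ / δ := by ring
    rw [e5, e6] at h4
    change f (Z₁ + (inl h + inr h')) ≤ f Z₁ + (⟪p.fst, h⟫ + ⟪p.snd, h'⟫) at h3
    linarith
  have hcore2 : ∀ h h' : E, ⟪X0 h, h⟫ + ⟪Y0 h', h'⟫ ≤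
      ‖h - h'‖ ^ 2 / δ + 4 * μ * (‖h‖ ^ 2 + ‖h'‖ ^ 2) := by
    intro h h'
    set τ := s / (1 + ‖h‖ + ‖h'‖) with hτ
    have hdn : 0 < 1 + ‖h‖ + ‖h'‖ := by positivity
    have hτ0 : 0 < τ := by positivity
    have hτs : τ * (1 + ‖h‖ + ‖h'‖) = s := by rw [hτ]; field_simp
    have n1 : ‖τ • h‖ ≤ s := by
      rw [norm_smul, Real.norm_eq_abs, abs_of_pos hτ0]
      nlinarith [norm_nonneg h, norm_nonneg h', mul_nonneg hτ0.le (norm_nonneg h')]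
    have n2 : ‖τ • h'‖ ≤ s := by
      rw [norm_smul, Real.norm_eq_abs, abs_of_pos hτ0]
      nlinarith [norm_nonneg h, norm_nonneg h', mul_nonneg hτ0.le (norm_nonneg h)]
    have := hcore (τ • h) (τ • h') n1 n2
    rw [← smul_sub, map_smul, map_smul, inner_smul_left, inner_smul_left, inner_smul_right, inner_smul_right,
      norm_smul, norm_smul, norm_smul, Real.norm_eq_abs, abs_of_pos hτ0] at this
    simp only [conj_trivial] at this
    have h2 : 0 < τ ^ 2 := by positivity
    have : τ ^ 2 * (⟪X0 h, h⟫ + ⟪Y0 h', h'⟫) ≤ τ ^ 2 * (‖h - h'‖ ^ 2 / δ + 4 * μ * (‖h‖ ^ 2 + ‖h'‖ ^ 2)) := by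
      calc _ = τ * (τ * ⟪X0 h, h⟫) + τ * (τ * ⟪Y0 h', h'⟫) := by ring
        _ ≤ _ := this
        _ = _ := by ring
    exact le_of_mul_le_mul_left this h2
  have hid : ∀ h : E, ⟪(ContinuousLinearMap.id ℝ E) h, h⟫ = ‖h‖ ^ 2 := fun h => real_inner_self_eq_norm_sq h
  have hXq : ∀ h, ⟪(X0 + (2 * μ) • ContinuousLinearMap.id ℝ E) h, h⟫ = ⟪X0 h, h⟫ + 2 * μ * ‖h‖ ^ 2 := by
    intro h
    have : (X0 + (2 * μ) • ContinuousLinearMap.id ℝ E) h = X0 h + (2 * μ) • h := rfl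
    rw [this, inner_add_left, inner_smul_left, real_inner_self_eq_norm_sq]
    simp
  have hYq : ∀ h, ⟪(Y0 + (2 * μ) • ContinuousLinearMap.id ℝ E) h, h⟫ = ⟪Y0 h, h⟫ + 2 * μ * ‖h‖ ^ 2 := by
    intro h
    have : (Y0 + (2 * μ) • ContinuousLinearMap.id ℝ E) h = Y0 h + (2 * μ) • h := rfl
    rw [this, inner_add_left, inner_smul_left, real_inner_self_eq_norm_sq]
    simp
  have hdiff : ‖(1 / δ) • (z₁ - z₁') - (1 / δ) • (z₀ - z₀')‖ ≤ 2 / δ * ρ' := by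
    have e1 : (1 / δ) • (z₁ - z₁') - (1 / δ) • (z₀ - z₀') = (1 / δ) • ((z₁ - z₀) - (z₁' - z₀')) := by
      rw [← smul_sub]; congr 1; abel
    rw [e1, norm_smul, Real.norm_eq_abs, abs_of_pos (by positivity)]
    have e2 := norm_sub_le (z₁ - z₀) (z₁' - z₀')
    calc 1 / δ * ‖z₁ - z₀ - (z₁' - z₀')‖ ≤ 1 / δ * (2 * ρ') := by gcongr; linarith
      _ = _ := by ring
  have hsm : ∀ a : E, ‖a‖ ≤ ρ' → ‖(2 * μ) • a‖ ≤ 2 * μ * ρ' := by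
    intro a ha
    rw [norm_smul, Real.norm_eq_abs, abs_of_pos (by positivity)]
    gcongr
  have htot : ρ' + 2 / δ * ρ' + 2 * μ * ρ' ≤ ρ := by
    calc _ = ρ' * (1 + 2 / δ + 2 * μ) := by ring
      _ = min 1 ρ := hρ'm
      _ ≤ ρ := min_le_right _ _
  refine ⟨z₁, z₁', P, Q, X0 + (2 * μ) • ContinuousLinearMap.id ℝ E, Y0 + (2 * μ) • ContinuousLinearMap.id ℝ E,
    ?_, ?_, ?_, ?_, ⟨s, hs, ?_⟩, ⟨s, hs, ?_⟩⟩
  · have h1 := htouch Z₀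
    have h2 : ⟪p, Z₀ - Z₁⟫ ≤ ρ' * ρ' := by
      refine (real_inner_le_norm _ _).trans ?_
      rw [norm_sub_rev]
      gcongr
    have h3 : f Z₀ = V z₀ + W z₀' - ‖z₀ - z₀'‖ ^ 2 / (2 * δ) := by
      simp [hf, hZ₀]
    have h4 : f Z₁ ≤ V z₁ + W z₁' - ‖z₁ - z₁'‖ ^ 2 / (2 * δ) := by
      simp only [hf, ← hz₁, ← hz₁']
      have : 0 ≤ μ * ‖Z₁ - Z₀‖ ^ 2 := by positivity
      linarith
    nlinarith
  · have e : P - (1 / δ) • (z₀ - z₀') = p.fst + ((1 / δ) • (z₁ - z₁') - (1 / δ) • (z₀ - z₀')) + (2 * μ) • (z₁ - z₀) := by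
      rw [hP]; abel
    rw [e]
    have n1 := norm_add₃_le (a := p.fst) (b := (1 / δ) • (z₁ - z₁') - (1 / δ) • (z₀ - z₀')) (c := (2 * μ) • (z₁ - z₀))
    have n2 := (hfstle p).trans hp
    have n3 := hsm _ hd1
    linarith
  · have e : Q + (1 / δ) • (z₀ - z₀') = p.snd - ((1 / δ) • (z₁ - z₁') - (1 / δ) • (z₀ - z₀')) + (2 * μ) • (z₁' - z₀') := by
      rw [hQ]; abel
    rw [e]
    have n1 := norm_add_le (p.snd - ((1 / δ) • (z₁ - z₁') - (1 / δ) • (z₀ - z₀'))) ((2 * μ) • (z₁' - z₀'))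
    have n1' := norm_sub_le p.snd ((1 / δ) • (z₁ - z₁') - (1 / δ) • (z₀ - z₀'))
    have n2 := (hsndle p).trans hp
    have n3 := hsm _ hd2
    linarith
  · intro h h'
    rw [hXq, hYq]
    have := hcore2 h h'
    have e : ρ = 8 * μ := by rw [hμdef]; ring
    rw [e]
    nlinarith [mul_nonneg hμ.le (sq_nonneg ‖h‖), mul_nonneg hμ.le (sq_nonneg ‖h'‖)]
  · intro h hh
    rw [hXq]
    have := (abs_le.1 (hVexp h hh)).2
    linarith
  · intro h hh
    rw [hYq]
    have := (abs_le.1 (hWexp h hh)).2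
    linarith

end Sums

end Part2

section Part3

section Sums2

variable {E : Type*} [NormedAddCommGroup E] [InnerProductSpace ℝ E]

theorem usc_pair {F : Type*} [TopologicalSpace F] {K : Set F} {u w : F → ℝ}
    (hu : UpperSemicontinuousOn u K) (hw : UpperSemicontinuousOn w K) :
    UpperSemicontinuousOn (fun q : F × F => u q.1 + w q.2) (K ×ˢ K) := by
  apply UpperSemicontinuousOn.add
  · exact UpperSemicontinuousOn.comp hu continuousOn_fst (fun q hq => hq.1)
  · exact UpperSemicontinuousOn.comp hw continuousOn_snd (fun q hq => hq.2)

/-- The theorem on sums. -/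
theorem sums [FiniteDimensional ℝ E] {K : Set E} (hK : IsCompact K) (hne : K.Nonempty) {u w : E → ℝ}
    (hu : UpperSemicontinuousOn u K) (hw : UpperSemicontinuousOn w K) {δ : ℝ} (hδ : 0 < δ) :
    ∃ P0 : E, ∀ ρ > 0, ∃ ζ ∈ K, ∃ η ∈ K, ∃ P Q : E, ∃ X Y : E →L[ℝ] E,
      ‖P - P0‖ ≤ ρ ∧ ‖Q + P0‖ ≤ ρ ∧
      (∀ ζ' ∈ K, ∀ η' ∈ K, u ζ' + w η' - ‖ζ' - η'‖ ^ 2 / (6 * δ) ≤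
        u ζ + w η - ‖ζ - η‖ ^ 2 / (6 * δ) + ρ) ∧
      (∀ h h' : E, ⟪X h, h⟫ + ⟪Y h', h'⟫ ≤ ‖h - h'‖ ^ 2 / δ + ρ * (‖h‖ ^ 2 + ‖h'‖ ^ 2)) ∧
      (∃ s > 0, ∀ ζ' ∈ K, ‖ζ' - ζ‖ ≤ s → u ζ' ≤ u ζ + ⟪P, ζ' - ζ⟫ + 1 / 2 * ⟪X (ζ' - ζ), ζ' - ζ⟫) ∧
      (∃ s > 0, ∀ η' ∈ K, ‖η' - η‖ ≤ s → w η' ≤ w η + ⟪Q, η' - η⟫ + 1 / 2 * ⟪Y (η' - η), η' - η⟫) := by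
  obtain ⟨V, π, hV1, hV2⟩ := supconv_exists hK hne hu δ
  obtain ⟨W, π', hW1, hW2⟩ := supconv_exists hK hne hw δ
  have cV := supconv_convex hδ hV1 hV2
  have cW := supconv_convex hδ hW1 hW2
  have husc : UpperSemicontinuousOn (fun q : E × E => (u q.1 + w q.2) + -(‖q.1 - q.2‖ ^ 2 / (6 * δ))) (K ×ˢ K) := by
    apply (usc_pair hu hw).add
    apply ContinuousOn.upperSemicontinuousOn
    fun_prop
  obtain ⟨⟨ζ₀, η₀⟩, ⟨hζ₀, hη₀⟩, hmaxq⟩ := husc.exists_isMaxOn (hne.prod hne) (hK.prod hK)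
  have hmax : ∀ ζ ∈ K, ∀ η ∈ K, u ζ + w η - ‖ζ - η‖ ^ 2 / (6 * δ) ≤ u ζ₀ + w η₀ - ‖ζ₀ - η₀‖ ^ 2 / (6 * δ) := by
    intro ζ hζ η hη
    have := hmaxq (a := (ζ, η)) ⟨hζ, hη⟩
    simp only [mem_ofPred_eq] at this
    linarith
  simp only at hζ₀ hη₀
  have hFle : ∀ z z', V z + W z' - ‖z - z'‖ ^ 2 / (2 * δ) ≤
      u (π z) + w (π' z') - ‖π z - π' z'‖ ^ 2 / (6 * δ) := by
    intro z z'
    rw [(hV1 z).2, (hW1 z').2]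
    have e : π z - π' z' = (π z - z) + (z - z') + -(π' z' - z') := by abel
    have n : ‖π z - π' z'‖ ≤ ‖π z - z‖ + ‖z - z'‖ + ‖π' z' - z'‖ := by
      rw [e]
      refine norm_add₃_le.trans ?_
      rw [norm_neg]
    have n2 : ‖π z - π' z'‖ ^ 2 ≤ 3 * (‖π z - z‖ ^ 2 + ‖z - z'‖ ^ 2 + ‖π' z' - z'‖ ^ 2) := by
      have : ‖π z - π' z'‖ ^ 2 ≤ (‖π z - z‖ + ‖z - z'‖ + ‖π' z' - z'‖) ^ 2 := by gcongr
      nlinarith [sq_nonneg (‖π z - z‖ - ‖z - z'‖), sq_nonneg (‖π z - z‖ - ‖π' z' - z'‖),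
        sq_nonneg (‖z - z'‖ - ‖π' z' - z'‖)]
    have n3 : ‖π z - π' z'‖ ^ 2 / (6 * δ) ≤ 3 * (‖π z - z‖ ^ 2 + ‖z - z'‖ ^ 2 + ‖π' z' - z'‖ ^ 2) / (6 * δ) := by
      gcongr
    have n4 : 3 * (‖π z - z‖ ^ 2 + ‖z - z'‖ ^ 2 + ‖π' z' - z'‖ ^ 2) / (6 * δ) =
      ‖π z - z‖ ^ 2 / (2 * δ) + ‖z - z'‖ ^ 2 / (2 * δ) + ‖π' z' - z'‖ ^ 2 / (2 * δ) := by
      field_simp; ring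
    linarith
  set z₀ := ζ₀ + (1 / 3 : ℝ) • (η₀ - ζ₀) with hz₀
  set z₀' := ζ₀ + (2 / 3 : ℝ) • (η₀ - ζ₀) with hz₀'
  have hF0 : u ζ₀ + w η₀ - ‖ζ₀ - η₀‖ ^ 2 / (6 * δ) ≤ V z₀ + W z₀' - ‖z₀ - z₀'‖ ^ 2 / (2 * δ) := by
    have h1 := hV2 z₀ ζ₀ hζ₀
    have h2 := hW2 z₀' η₀ hη₀
    have e1 : ζ₀ - z₀ = (1 / 3 : ℝ) • (ζ₀ - η₀) := by rw [hz₀]; module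
    have e2 : η₀ - z₀' = (-(1 / 3) : ℝ) • (ζ₀ - η₀) := by rw [hz₀']; module
    have e3 : z₀ - z₀' = (1 / 3 : ℝ) • (ζ₀ - η₀) := by rw [hz₀, hz₀']; module
    rw [e1, norm_smul, mul_pow] at h1
    rw [e2, norm_smul, mul_pow] at h2
    rw [e3, norm_smul, mul_pow]
    norm_num at h1 h2 ⊢
    have e4 : ‖ζ₀ - η₀‖ ^ 2 / (6 * δ) = 3 * (1 / 9 * ‖ζ₀ - η₀‖ ^ 2 / (2 * δ)) := by field_simp; ring
    rw [e4]
    linarith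
  have hFmax : ∀ z z', V z + W z' - ‖z - z'‖ ^ 2 / (2 * δ) ≤ V z₀ + W z₀' - ‖z₀ - z₀'‖ ^ 2 / (2 * δ) :=
    fun z z' => (hFle z z').trans ((hmax _ (hV1 z).1 _ (hW1 z').1).trans hF0)
  refine ⟨(1 / δ) • (z₀ - z₀'), fun ρ hρ => ?_⟩
  obtain ⟨z₁, z₁', P, Q, X, Y, h1, h2, h3, h4, ⟨s, hs, h5⟩, ⟨s', hs', h6⟩⟩ := jensen_pair hδ cV cW hFmax hρ
  refine ⟨π z₁, (hV1 z₁).1, π' z₁', (hW1 z₁').1, P, Q, X, Y, h2, h3, ?_, h4, ⟨s, hs, ?_⟩, ⟨s', hs', ?_⟩⟩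
  · intro ζ' hζ' η' hη'
    have a1 := hmax ζ' hζ' η' hη'
    have a2 := hFle z₁ z₁'
    linarith
  · intro ζ' hζ' hn
    have a1 := h5 _ hn
    have a2 := hV2 (z₁ + (ζ' - π z₁)) ζ' hζ'
    have a3 := (hV1 z₁).2
    have e : ζ' - (z₁ + (ζ' - π z₁)) = π z₁ - z₁ := by abel
    rw [e] at a2
    linarith
  · intro ζ' hζ' hn
    have a1 := h6 _ hn
    have a2 := hW2 (z₁' + (ζ' - π' z₁')) ζ' hζ'
    have a3 := (hW1 z₁').2
    have e : ζ' - (z₁' + (ζ' - π' z₁')) = π' z₁' - z₁' := by abel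
    rw [e] at a2
    linarith

/-- Compactness: a strict diagonal bound extends near the diagonal. -/
theorem near_diag {K C : Set E} (hK : IsCompact K) (hC : IsCompact C) (hCK : C ⊆ K) {u w : E → ℝ}
    (hu : UpperSemicontinuousOn u K) (hw : UpperSemicontinuousOn w K) {c : ℝ}
    (hdiag : ∀ ζ ∈ C, u ζ + w ζ < c) :
    ∃ r > 0, ∀ ζ ∈ K, ∀ η ∈ K, (ζ ∈ C ∨ η ∈ C) → ‖ζ - η‖ < r → u ζ + w η < c := by
  set S : Set (E × E) := (K ×ˢ K) ∩ (fun q : E × E => u q.1 + w q.2) ⁻¹' Ici c with hS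
  have hScomp : IsCompact S := (usc_pair hu hw).isCompact_inter_preimage_Ici (hK.prod hK) c
  set S' : Set (E × E) := S ∩ ((C ×ˢ univ) ∪ (univ ×ˢ C)) with hS'
  have hS'c : IsCompact S' := hScomp.inter_right
    ((hC.isClosed.prod isClosed_univ).union (isClosed_univ.prod hC.isClosed))
  rcases S'.eq_empty_or_nonempty with he | hne
  · refine ⟨1, one_pos, fun ζ hζ η hη hor _ => ?_⟩
    by_contra hcon
    push Not at hcon
    have : (ζ, η) ∈ S' := by
      refine ⟨⟨⟨hζ, hη⟩, hcon⟩, ?_⟩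
      rcases hor with h | h
      · left; exact ⟨h, trivial⟩
      · right; exact ⟨trivial, h⟩
    rw [he] at this
    exact this
  · obtain ⟨⟨a, b⟩, hab, hmin⟩ := hS'c.exists_isMinOn hne (f := fun q : E × E => ‖q.1 - q.2‖) (by fun_prop)
    have hpos : 0 < ‖a - b‖ := by
      rw [norm_pos_iff, sub_ne_zero]
      rintro rfl
      obtain ⟨⟨_, h1⟩, h2⟩ := hab
      have hC' : a ∈ C := by
        rcases h2 with h | h
        · exact h.1
        · exact h.2
      have := hdiag a hC'
      have h1' : c ≤ u a + w a := h1
      linarith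
    refine ⟨‖a - b‖, hpos, fun ζ hζ η hη hor hn => ?_⟩
    by_contra hcon
    push Not at hcon
    have : (ζ, η) ∈ S' := by
      refine ⟨⟨⟨hζ, hη⟩, hcon⟩, ?_⟩
      rcases hor with h | h
      · left; exact ⟨h, trivial⟩
      · right; exact ⟨trivial, h⟩
    have := hmin this
    simp only [mem_ofPred_eq] at this
    linarith

/-- Penalization. -/
theorem penalization {K O : Set E} (hK : IsCompact K) (hO : IsOpen O) {u w : E → ℝ}
    (hu : UpperSemicontinuousOn u K) (hw : UpperSemicontinuousOn w K) {b : ℝ}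
    (hb : ∀ ζ ∈ K \ O, u ζ + w ζ ≤ b) {ζs : E} (hζs : ζs ∈ K) (hs : b < u ζs + w ζs) {τ : ℝ} (hτ : 0 < τ) :
    ∃ δ > 0, ∃ τ' > 0, ∀ ζ ∈ K, ∀ η ∈ K,
      (∀ ζ' ∈ K, ∀ η' ∈ K, u ζ' + w η' - ‖ζ' - η'‖ ^ 2 / (6 * δ) ≤
        u ζ + w η - ‖ζ - η‖ ^ 2 / (6 * δ) + τ') →
      ζ ∈ O ∧ η ∈ O ∧ ‖ζ - η‖ ≤ τ ∧ ‖ζ - η‖ ^ 2 / δ ≤ τ := by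
  -- maximum on the diagonal
  obtain ⟨ζm, hζm, hm⟩ := (hu.add hw).exists_isMaxOn ⟨ζs, hζs⟩ hK
  have hm' : ∀ ζ ∈ K, u ζ + w ζ ≤ u ζm + w ζm := fun ζ hζ => hm hζ
  set m0 := u ζm + w ζm with hm0
  have hbm : b < m0 := hs.trans_le (hm' _ hζs)
  obtain ⟨r1, hr1, hb1⟩ := near_diag hK (hK.diff hO) diff_subset hu hw (c := (b + m0) / 2)
    (fun ζ hζ => by have := hb ζ hζ; linarith)
  set τ2 := min (τ / 24) ((m0 - b) / 4) with hτ2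
  have hτ2p : 0 < τ2 := lt_min (by positivity) (by linarith)
  obtain ⟨r2, hr2, hb2⟩ := near_diag hK hK subset_rfl hu hw (c := m0 + τ2)
    (fun ζ hζ => by have := hm' ζ hζ; linarith)
  -- upper bound
  obtain ⟨S, hS⟩ := UpperSemicontinuousOn.bddAbove_of_isCompact (hK.prod hK) (usc_pair hu hw)
  have hS' : ∀ ζ ∈ K, ∀ η ∈ K, u ζ + w η ≤ S := fun ζ hζ η hη => hS ⟨(ζ, η), ⟨hζ, hη⟩, rfl⟩
  set r := min (min r1 r2) τ with hr
  have hrp : 0 < r := lt_min (lt_min hr1 hr2) hτ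
  have hSm : m0 ≤ S := hS' _ hζm _ hζm
  set δ := r ^ 2 / (12 * (S - m0 + τ2 + 1)) with hδ
  have hden : 0 < S - m0 + τ2 + 1 := by linarith
  have hδp : 0 < δ := by positivity
  refine ⟨δ, hδp, τ2, hτ2p, fun ζ hζ η hη hopt => ?_⟩
  have hopt' : m0 ≤ u ζ + w η - ‖ζ - η‖ ^ 2 / (6 * δ) + τ2 := by
    have := hopt ζm hζm ζm hζm
    simp only [sub_self, norm_zero] at this
    norm_num at this
    linarith
  have hlt : ‖ζ - η‖ < r := by
    by_contra hcon
    push Not at hcon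
    have h1 : r ^ 2 / (6 * δ) ≤ ‖ζ - η‖ ^ 2 / (6 * δ) := by gcongr
    have h2 : r ^ 2 / (6 * δ) = 2 * (S - m0 + τ2 + 1) := by
      rw [hδ]; field_simp; ring
    have := hS' ζ hζ η hη
    linarith
  have h2 := hb2 ζ hζ η hη (Or.inl hζ) (hlt.trans_le ((min_le_left _ _).trans (min_le_right _ _)))
  have hq : 0 ≤ ‖ζ - η‖ ^ 2 / (6 * δ) := by positivity
  have hτ2a : τ2 ≤ τ / 24 := min_le_left _ _
  have hτ2b : τ2 ≤ (m0 - b) / 4 := min_le_right _ _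
  have hnot : ¬ (ζ ∈ K \ O ∨ η ∈ K \ O) := by
    intro hor
    have := hb1 ζ hζ η hη hor (hlt.trans_le ((min_le_left _ _).trans (min_le_left _ _)))
    linarith
  push Not at hnot
  refine ⟨?_, ?_, hlt.le.trans (min_le_right _ _), ?_⟩
  · by_contra h; exact hnot.1 ⟨hζ, h⟩
  · by_contra h; exact hnot.2 ⟨hη, h⟩
  · have e : ‖ζ - η‖ ^ 2 / δ = 6 * (‖ζ - η‖ ^ 2 / (6 * δ)) := by field_simp
    rw [e]
    linarith

end Sums2

end Part3

/-! ### Part 3: Hamiltonian lemmas -/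

theorem ham_bdd {d : ℕ} {Λ : ℝ} {a M : ℝ → ℝ} (haM : GoodFamilies a M)
    {I : Type} {mi : I → ℝ} {Hi : I → Euc d → Euc d → ℝ} (hHi : ∀ i, MemB d (mi i) Λ a M (Hi i))
    (x p : Euc d) : BddBelow (range fun i => Hi i x p) := by
  refine ⟨-M (‖x‖ + 1), ?_⟩
  rintro _ ⟨i, rfl⟩
  have hr : 0 < ‖x‖ + 1 := by positivity
  have h := ((hHi i).2.2.2 (‖x‖ + 1) hr x (by simp) p).1
  have h2 : 0 ≤ a (‖x‖ + 1) * ‖p‖ ^ mi i := mul_nonneg (haM _ hr).1.1.le (by positivity)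
  simp only
  linarith

theorem ham_le {d : ℕ} {Λ : ℝ} {a M : ℝ → ℝ} (haM : GoodFamilies a M)
    {H : Euc d → Euc d → ℝ} {I : Type} {mi : I → ℝ} {Hi : I → Euc d → Euc d → ℝ}
    (hHi : ∀ i, MemB d (mi i) Λ a M (Hi i)) (hinf : ∀ x p : Euc d, H x p = ⨅ i, Hi i x p)
    (i : I) (x p : Euc d) : H x p ≤ Hi i x p := by
  rw [hinf]
  exact ciInf_le (ham_bdd haM hHi x p) i

theorem ham_near {d : ℕ} {H : Euc d → Euc d → ℝ} {I : Type} (hI : Nonempty I) {Hi : I → Euc d → Euc d → ℝ}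
    (hinf : ∀ x p : Euc d, H x p = ⨅ i, Hi i x p)
    (x p : Euc d) {ε : ℝ} (hε : 0 < ε) : ∃ i, Hi i x p < H x p + ε := by
  apply exists_lt_of_ciInf_lt
  rw [← hinf]
  linarith

theorem ham_exp {d : ℕ} (hd : 0 < d) {m Λ : ℝ} (hΛ : 0 < Λ) {a M : ℝ → ℝ} (haM : GoodFamilies a M)
    {H : Euc d → Euc d → ℝ} (hH : MemH d m Λ a M H) {I : Type} {mi : I → ℝ} (hmi : ∀ i, 1 < mi i)
    {Hi : I → Euc d → Euc d → ℝ}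
    (hHi : ∀ i, MemB d (mi i) Λ a M (Hi i)) (hinf : ∀ x p : Euc d, H x p = ⨅ i, Hi i x p)
    (i : I) : m ≤ mi i := by
  by_contra hcon
  push Not at hcon
  have ha := (haM 1 one_pos).1.1
  have hM := (haM 1 one_pos).2
  have ht : Tendsto (fun t : ℝ => t ^ (m - mi i)) atTop atTop := tendsto_rpow_atTop (by linarith)
  obtain ⟨t, ht1, ht2⟩ := ((ht.eventually_gt_atTop ((2 * Λ + M 1) / a 1)).and (eventually_ge_atTop 1)).exists
  set p : Euc d := t • EuclideanSpace.single ⟨0, hd⟩ (1 : ℝ) with hp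
  have hpn : ‖p‖ = t := by
    rw [hp, norm_smul]
    simp
    linarith
  have h1 := ((hH.2 1 one_pos).1 0 (by simp) p).1
  have h2 := ham_le haM hHi hinf i 0 p
  have h3 := ((hHi i).2.2.2 1 one_pos 0 (by simp) p).2
  rw [hpn] at h1 h3
  have ht0 : 0 < t := by linarith
  have e : t ^ m = t ^ (m - mi i) * t ^ mi i := by
    rw [← Real.rpow_add ht0]; congr 1; ring
  have h4 : 1 ≤ t ^ mi i := Real.one_le_rpow ht2 (by have := hmi i; linarith)
  rw [div_lt_iff₀ ha] at ht1
  have h5 : (2 * Λ + M 1) * t ^ mi i < (t ^ (m - mi i) * a 1) * t ^ mi i := by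
    apply mul_lt_mul_of_pos_right ht1; linarith
  rw [e] at h1
  nlinarith

theorem ham_G1 {d : ℕ} {Λ : ℝ} (hΛ : 0 < Λ) {a M : ℝ → ℝ} (haM : GoodFamilies a M)
    {H : Euc d → Euc d → ℝ} {I : Type} (hI : Nonempty I) {mi : I → ℝ} (hmi : ∀ i, 1 < mi i)
    {Hi : I → Euc d → Euc d → ℝ}
    (hHi : ∀ i, MemB d (mi i) Λ a M (Hi i)) (hinf : ∀ x p : Euc d, H x p = ⨅ i, Hi i x p)
    (x P q : Euc d) (hq : ‖q‖ ≤ 1) {l : ℝ} (hl0 : 0 ≤ l) (hl1 : l ≤ 1) :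
    H x (l • P + (1 - l) • q) ≤ l * H x P + 2 * Λ * (1 - l) := by
  apply le_of_forall_pos_le_add
  intro ε hε
  obtain ⟨i, hi⟩ := ham_near hI hinf x P hε
  have h1 := ham_le haM hHi hinf i x (l • P + (1 - l) • q)
  have h2 := ((hHi i).2.1 x).2 (mem_univ P) (mem_univ q) hl0 (by linarith : (0:ℝ) ≤ 1 - l) (by ring)
  have h3 := ((hHi i).2.2.2 (‖x‖ + 1) (by positivity) x (by simp) q).2
  have h4 : ‖q‖ ^ mi i ≤ 1 := Real.rpow_le_one (norm_nonneg _) hq (by have := hmi i; linarith)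
  simp only [smul_eq_mul] at h2
  have h5 : Hi i x q ≤ 2 * Λ := by nlinarith
  have h6 : (1 - l) * Hi i x q ≤ (1 - l) * (2 * Λ) := mul_le_mul_of_nonneg_left h5 (by linarith)
  have h7 : l * Hi i x P ≤ l * (H x P + ε) := mul_le_mul_of_nonneg_left hi.le hl0
  have h8 : l * ε ≤ ε := by nlinarith
  linarith

theorem ham_G2 {d : ℕ} (hd : 0 < d) {m Λ : ℝ} (hm : 1 < m) (hΛ : 0 < Λ) {a M : ℝ → ℝ} (haM : GoodFamilies a M)
    {H : Euc d → Euc d → ℝ} (hH : MemH d m Λ a M H) {I : Type} (hI : Nonempty I)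
    {mi : I → ℝ} (hmi : ∀ i, 1 < mi i)
    {Hi : I → Euc d → Euc d → ℝ}
    (hHi : ∀ i, MemB d (mi i) Λ a M (Hi i)) (hinf : ∀ x p : Euc d, H x p = ⨅ i, Hi i x p)
    {r : ℝ} (hr : 0 < r) {l : ℝ} (hl0 : 1 / 2 ≤ l) (hl1 : l < 1) :
    ∃ c > 0, ∃ C > 0, ∀ x ∈ ball (0 : Euc d) r, ∀ P q : Euc d, ‖q‖ ≤ 1 / 2 → 1 ≤ ‖P‖ →
      H x (l • P + (1 - l) • q) ≤ l * H x P - c * ‖P‖ ^ m + C := by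
  have ha := (haM r hr).1.1
  have hM := (haM r hr).2
  obtain ⟨θ, hθ0, hθ1, hθ2⟩ : ∃ θ : ℝ, 0 < θ ∧ θ ≤ 1 / 2 ∧ Λ * θ ^ (m - 1) ≤ a r / 2 := by
    refine ⟨min (1 / 2) ((a r / (2 * Λ)) ^ (1 / (m - 1))), lt_min (by norm_num) (by positivity), min_le_left _ _, ?_⟩
    have h1 : (min (1 / 2) ((a r / (2 * Λ)) ^ (1 / (m - 1)))) ^ (m - 1) ≤ ((a r / (2 * Λ)) ^ (1 / (m - 1))) ^ (m - 1) := by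
      apply Real.rpow_le_rpow (by positivity) (min_le_right _ _) (by linarith)
    rw [← Real.rpow_mul (by positivity), one_div_mul_cancel (by linarith), Real.rpow_one] at h1
    calc _ ≤ Λ * (a r / (2 * Λ)) := by gcongr
      _ = _ := by field_simp
  set γ := (1 - l) / 2 with hγ
  set β := (1 - l) / (2 * (1 - θ)) with hβ
  have hγ0 : 0 < γ := by rw [hγ]; linarith
  have h1θ : 0 < 1 - θ := by linarith
  have hβ0 : 0 < β := by rw [hβ]; apply div_pos <;> linarith
  have hβθ : β * (1 - θ) = (1 - l) / 2 := by rw [hβ]; field_simp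
  set α := (1 + l) / 2 - β with hα
  have hα0 : 0 ≤ α := by
    rw [hα]; nlinarith
  refine ⟨β * θ * (a r / 2), by positivity, β * θ * M r + β * Λ + 2 * Λ * γ + 1, by positivity, ?_⟩
  intro x hx P q hq hP
  obtain ⟨i, hi⟩ := ham_near hI hinf x P one_pos
  have hmm := ham_exp hd hΛ haM hH hmi hHi hinf i
  have h1 := ham_le haM hHi hinf i x (l • P + (1 - l) • q)
  have hconv := (hHi i).2.1 x
  -- two-step convexity
  have e : l • P + (1 - l) • q = (1 - γ) • ((α / (1 - γ)) • P + (β / (1 - γ)) • (θ • P)) + γ • ((2 : ℝ) • q) := by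
    have : 1 - γ ≠ 0 := by rw [hγ]; intro h; linarith
    rw [smul_add, smul_smul, smul_smul, smul_smul, smul_smul, mul_div_cancel₀ _ this, mul_div_cancel₀ _ this,
      ← add_smul]
    congr 2
    · rw [hα]; linarith
    · rw [hγ]; ring
  have hγ1 : 0 < 1 - γ := by rw [hγ]; linarith
  have hαβ : α + β = 1 - γ := by rw [hα, hγ]; ring
  have h2 := hconv.2 (mem_univ ((α / (1 - γ)) • P + (β / (1 - γ)) • (θ • P))) (mem_univ ((2 : ℝ) • q)) hγ1.le hγ0.le (by ring)
  have h3 := hconv.2 (mem_univ P) (mem_univ (θ • P)) (div_nonneg hα0 hγ1.le) (div_nonneg hβ0.le hγ1.le)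
    (by rw [← add_div, hαβ, div_self hγ1.ne'])
  rw [← e] at h2
  simp only [smul_eq_mul] at h2 h3
  have h3' : (1 - γ) * Hi i x ((α / (1 - γ)) • P + (β / (1 - γ)) • (θ • P)) ≤ α * Hi i x P + β * Hi i x (θ • P) := by
    calc _ ≤ (1 - γ) * (α / (1 - γ) * Hi i x P + β / (1 - γ) * Hi i x (θ • P)) := mul_le_mul_of_nonneg_left h3 hγ1.le
      _ = _ := by field_simp
  have g1 := ((hHi i).2.2.2 r hr x hx P).1
  have g2 := ((hHi i).2.2.2 r hr x hx (θ • P)).2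
  have g3 := ((hHi i).2.2.2 r hr x hx ((2 : ℝ) • q)).2
  have g4 : ‖(2 : ℝ) • q‖ ^ mi i ≤ 1 := by
    apply Real.rpow_le_one (norm_nonneg _) _ (by have := hmi i; linarith)
    rw [norm_smul]; norm_num; linarith
  have g5 : Hi i x ((2 : ℝ) • q) ≤ 2 * Λ := by nlinarith
  rw [norm_smul, Real.norm_eq_abs, abs_of_pos hθ0, Real.mul_rpow hθ0.le (norm_nonneg _)] at g2
  set N := ‖P‖ ^ mi i with hN
  have hN0 : 0 ≤ N := by positivity
  have hNm : ‖P‖ ^ m ≤ N := Real.rpow_le_rpow_of_exponent_le hP hmm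
  have g6 : Λ * θ ^ mi i ≤ θ * (a r / 2) := by
    have e1 : θ ^ mi i = θ * θ ^ (mi i - 1) := by
      rw [← Real.rpow_one_add' hθ0.le]; congr 1; ring
      have := hmi i; intro h; linarith
    have e2 : θ ^ (mi i - 1) ≤ θ ^ (m - 1) :=
      Real.rpow_le_rpow_of_exponent_ge hθ0 (by linarith) (by linarith)
    rw [e1]
    calc Λ * (θ * θ ^ (mi i - 1)) = θ * (Λ * θ ^ (mi i - 1)) := by ring
      _ ≤ θ * (Λ * θ ^ (m - 1)) := by gcongr
      _ ≤ _ := by gcongr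
  have g7 : β * Hi i x (θ • P) ≤ β * (θ * (a r / 2) * N + Λ) := by
    apply mul_le_mul_of_nonneg_left _ hβ0.le
    calc _ ≤ _ := g2
      _ = (Λ * θ ^ mi i) * N + Λ := by ring
      _ ≤ _ := by gcongr
  have g8 : α * Hi i x P ≤ l * Hi i x P - β * θ * (a r * N - M r) := by
    have : α = l - β * θ := by rw [hα]; linarith
    rw [this]
    have := mul_le_mul_of_nonneg_left g1 (by positivity : 0 ≤ β * θ)
    linarith
  have g9 : γ * Hi i x ((2 : ℝ) • q) ≤ γ * (2 * Λ) := mul_le_mul_of_nonneg_left g5 hγ0.le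
  have g10 : l * Hi i x P ≤ l * (H x P + 1) := mul_le_mul_of_nonneg_left hi.le (by linarith)
  have g11 : β * θ * (a r / 2) * ‖P‖ ^ m ≤ β * θ * (a r / 2) * N := by gcongr
  nlinarith

theorem ham_main {d : ℕ} (hd : 0 < d) {m Λ : ℝ} (hm : 1 < m) (hΛ : 0 < Λ) {a M : ℝ → ℝ} (haM : GoodFamilies a M)
    {H : Euc d → Euc d → ℝ} (hH : MemH d m Λ a M H) {I : Type} (hI : Nonempty I)
    {mi : I → ℝ} (hmi : ∀ i, 1 < mi i)
    {Hi : I → Euc d → Euc d → ℝ}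
    (hHi : ∀ i, MemB d (mi i) Λ a M (Hi i)) (hinf : ∀ x p : Euc d, H x p = ⨅ i, Hi i x p)
    {r : ℝ} (hr : 0 < r) {l : ℝ} (hl0 : 1 / 2 ≤ l) (hl1 : l < 1) :
    ∃ τ > 0, ∀ x ∈ ball (0 : Euc d) r, ∀ y ∈ ball (0 : Euc d) r, ‖x - y‖ ≤ τ → ∀ P q : Euc d, ‖q‖ ≤ 1 / 2 →
      H y (l • P + (1 - l) • q) ≤ l * H x P + (2 * Λ + 1 / 2) * (1 - l) := by
  obtain ⟨c, hc, C, hC, hG2⟩ := ham_G2 hd hm hΛ haM hH hI hmi hHi hinf hr hl0 hl1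
  have hM := (haM r hr).2
  set R0 := max 1 (2 * (C + 1) / c) with hR0
  have hR01 : 1 ≤ R0 := le_max_left _ _
  have hR0c : C + 1 ≤ c / 2 * R0 := by
    have : 2 * (C + 1) / c ≤ R0 := le_max_right _ _
    rw [div_le_iff₀ hc] at this
    linarith
  have hMpos : 0 < M r := by linarith
  set D := Λ * (R0 + 1) ^ m + M r with hD
  have hDpos : 0 < D := by positivity
  have h1l : 0 < 1 - l := by linarith
  set τ := min (min (c / (2 * (Λ * 2 ^ m))) (1 / M r)) ((1 - l) / (2 * D)) with hτ
  have hτ0 : 0 < τ := by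
    refine lt_min (lt_min ?_ ?_) ?_ <;> positivity
  have hτ1 : Λ * 2 ^ m * τ ≤ c / 2 := by
    have : τ ≤ c / (2 * (Λ * 2 ^ m)) := (min_le_left _ _).trans (min_le_left _ _)
    rw [le_div_iff₀ (by positivity)] at this
    linarith
  have hτ2 : M r * τ ≤ 1 := by
    have : τ ≤ 1 / M r := (min_le_left _ _).trans (min_le_right _ _)
    rw [le_div_iff₀ (by positivity)] at this
    linarith
  have hτ3 : D * τ ≤ (1 - l) / 2 := by
    have : τ ≤ (1 - l) / (2 * D) := min_le_right _ _
    rw [le_div_iff₀ (by positivity)] at this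
    linarith
  refine ⟨τ, hτ0, fun x hx y hy hxy P q hq => ?_⟩
  set p := l • P + (1 - l) • q with hp
  have hpn : ‖p‖ ≤ ‖P‖ + 1 := by
    rw [hp]
    refine (norm_add_le _ _).trans ?_
    rw [norm_smul, norm_smul, Real.norm_eq_abs, Real.norm_eq_abs, abs_of_pos (by linarith), abs_of_pos h1l]
    nlinarith [norm_nonneg P, norm_nonneg q]
  have hx1 := (abs_le.1 ((hH.2 r hr).2 x hx y hy p)).1
  have hx2 : (Λ * ‖p‖ ^ m + M r) * ‖x - y‖ ≤ (Λ * ‖p‖ ^ m + M r) * τ := by gcongr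
  have hPm : 0 ≤ ‖P‖ := norm_nonneg _
  by_cases hcase : ‖P‖ ≤ R0
  · have g1 := ham_G1 hΛ haM hI hmi hHi hinf x P q (by linarith) (by linarith : 0 ≤ l) hl1.le
    have g2 : (Λ * ‖p‖ ^ m + M r) * τ ≤ D * τ := by
      have : ‖p‖ ^ m ≤ (R0 + 1) ^ m := Real.rpow_le_rpow (norm_nonneg _) (by linarith) (by linarith)
      rw [hD]
      gcongr
    rw [← hp] at g1
    linarith
  · push Not at hcase
    have hP1 : 1 ≤ ‖P‖ := by linarith
    have g1 := hG2 x hx P q hq hP1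
    rw [← hp] at g1
    have g2 : ‖p‖ ^ m ≤ 2 ^ m * ‖P‖ ^ m := by
      rw [← Real.mul_rpow (by norm_num) hPm]
      exact Real.rpow_le_rpow (norm_nonneg _) (by linarith) (by linarith)
    have g3 : ‖P‖ ≤ ‖P‖ ^ m := by
      conv_lhs => rw [← Real.rpow_one ‖P‖]
      exact Real.rpow_le_rpow_of_exponent_le hP1 hm.le
    have g4 : (Λ * ‖p‖ ^ m + M r) * τ ≤ (Λ * (2 ^ m * ‖P‖ ^ m) + M r) * τ := by gcongr
    have g5 : (Λ * (2 ^ m * ‖P‖ ^ m) + M r) * τ = (Λ * 2 ^ m * τ) * ‖P‖ ^ m + M r * τ := by ring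
    have g6 : (Λ * 2 ^ m * τ) * ‖P‖ ^ m ≤ c / 2 * ‖P‖ ^ m := by gcongr
    have g7 : c / 2 * R0 ≤ c / 2 * ‖P‖ ^ m := by
      have : R0 ≤ ‖P‖ ^ m := by linarith
      gcongr
    have g8 : 0 ≤ (2 * Λ + 1 / 2) * (1 - l) := by positivity
    nlinarith

/-! ### Part 4: test functions -/

/-- The Japanese bracket. -/
def jb {d : ℕ} (x : Euc d) : ℝ := Real.sqrt (1 + ‖x‖ ^ 2)

theorem jb_pos {d : ℕ} (x : Euc d) : 0 < jb x := Real.sqrt_pos.2 (by positivity)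

theorem jb_sq {d : ℕ} (x : Euc d) : jb x ^ 2 = 1 + ‖x‖ ^ 2 := Real.sq_sqrt (by positivity)

theorem jb_ge_one {d : ℕ} (x : Euc d) : 1 ≤ jb x := by
  nlinarith [jb_pos x, jb_sq x, sq_nonneg ‖x‖]

theorem jb_ge_norm {d : ℕ} (x : Euc d) : ‖x‖ ≤ jb x := by
  nlinarith [jb_pos x, jb_sq x, norm_nonneg x]

theorem jb_contDiff {d : ℕ} {n : WithTop ℕ∞} : ContDiff ℝ n (jb (d := d)) := by
  unfold jb
  apply ContDiff.sqrt
  · exact contDiff_const.add (contDiff_norm_sq ℝ)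
  · intro x; positivity

theorem jb_hasFDerivAt {d : ℕ} (y : Euc d) : HasFDerivAt (jb (d := d)) ((1 / jb y) • innerSL ℝ y) y := by
  have h1 : HasFDerivAt (fun y : Euc d => 1 + ‖y‖ ^ 2) (2 • innerSL ℝ y) y :=
    (hasStrictFDerivAt_norm_sq y).hasFDerivAt.const_add 1
  have h2 := h1.sqrt (by positivity)
  refine h2.congr_fderiv ?_
  ext h
  simp [jb]
  ring

/-- Columns of a matrix. -/
def colv {d n : ℕ} (S : Matrix (Fin d) (Fin n) ℝ) (k : Fin n) : Euc d := WithLp.toLp 2 (fun i => S i k)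

theorem colv_eq {d n : ℕ} (S : Matrix (Fin d) (Fin n) ℝ) (k : Fin n) :
    colv S k = ∑ i, S i k • EuclideanSpace.single i (1 : ℝ) := by
  ext j
  simp [colv, Pi.single_apply]

theorem colv_sub {d n : ℕ} (S R : Matrix (Fin d) (Fin n) ℝ) (k : Fin n) :
    colv (S - R) k = colv S k - colv R k := by
  ext j
  simp [colv]

theorem colv_norm {d n : ℕ} (S : Matrix (Fin d) (Fin n) ℝ) :
    ∑ k, ‖colv S k‖ ^ 2 = matFrobNorm S ^ 2 := by
  unfold matFrobNorm
  rw [Real.sq_sqrt (by positivity), Finset.sum_comm]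
  apply Finset.sum_congr rfl
  intro k _
  rw [EuclideanSpace.norm_sq_eq]
  simp [colv]

theorem trace_hess {d n : ℕ} (S : Matrix (Fin d) (Fin n) ℝ) {f : Euc d → ℝ} {x : Euc d}
    (hf : DifferentiableAt ℝ (fderiv ℝ f) x) :
    Matrix.trace (S * S.transpose * Matrix.of fun i j =>
      fderiv ℝ (fun y => fderiv ℝ f y (EuclideanSpace.single j 1)) x (EuclideanSpace.single i 1)) =
    ∑ k, fderiv ℝ (fun y => fderiv ℝ f y (colv S k)) x (colv S k) := by
  have key : ∀ c h : Euc d, fderiv ℝ (fun y => fderiv ℝ f y c) x h = fderiv ℝ (fderiv ℝ f) x h c := by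
    intro c h
    rw [fderiv_clm_apply hf (by fun_prop)]
    simp
  simp only [key, Matrix.trace, Matrix.diag, Matrix.mul_apply, Matrix.transpose_apply, Matrix.of_apply]
  have e : ∀ k, (fderiv ℝ (fderiv ℝ f) x (colv S k)) (colv S k) =
      ∑ i, ∑ j, S i k * S j k * fderiv ℝ (fderiv ℝ f) x (EuclideanSpace.single j 1) (EuclideanSpace.single i 1) := by
    intro k
    rw [colv_eq]
    simp only [map_sum, map_smul, sum_apply, smul_apply, smul_eq_mul, Finset.mul_sum]
    apply Finset.sum_congr rfl
    intro i _
    apply Finset.sum_congr rfl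
    intro j _
    ring
  simp only [e, Finset.sum_mul]
  rw [Finset.sum_comm' (t' := Finset.univ) (s' := fun _ => Finset.univ) (by simp)]
  conv_rhs => rw [Finset.sum_comm]
  rw [Finset.sum_comm]
  apply Finset.sum_congr rfl
  intro i _
  rw [Finset.sum_comm]

abbrev TX (d : ℕ) := WithLp 2 (ℝ × Euc d)

/-- Injection of the space variable. -/
def inrX (d : ℕ) : Euc d →L[ℝ] TX d :=
  ((WithLp.prodContinuousLinearEquiv 2 ℝ ℝ (Euc d)).symm : ℝ × Euc d →L[ℝ] TX d).comp
      (ContinuousLinearMap.inr ℝ ℝ (Euc d))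

/-- Injection of the time variable. -/
def inlX (d : ℕ) : ℝ →L[ℝ] TX d :=
  ((WithLp.prodContinuousLinearEquiv 2 ℝ ℝ (Euc d)).symm : ℝ × Euc d →L[ℝ] TX d).comp
      (ContinuousLinearMap.inl ℝ ℝ (Euc d))

theorem TX_inner {d : ℕ} (p q : TX d) : ⟪p, q⟫ = p.fst * q.fst + ⟪p.snd, q.snd⟫ := by
  have h : ⟪p, q⟫ = ⟪p.fst, q.fst⟫ + ⟪p.snd, q.snd⟫ := WithLp.prod_inner_apply p q
  rw [h]
  simp [mul_comm]

theorem inrX_norm {d : ℕ} (h : Euc d) : ‖inrX d h‖ = ‖h‖ := by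
  have h0 : ‖inrX d h‖ ^ 2 = ‖h‖ ^ 2 := by
    rw [← real_inner_self_eq_norm_sq, ← real_inner_self_eq_norm_sq, TX_inner]
    have a : (inrX d h).fst = 0 := rfl
    have b : (inrX d h).snd = h := rfl
    rw [a, b]; ring
  exact (sq_eq_sq₀ (norm_nonneg _) (norm_nonneg _)).1 h0

/-- The quadratic part. -/
def quadf {d : ℕ} (P : TX d) (X : TX d →L[ℝ] TX d) (z : TX d) : ℝ := ⟪P, z⟫ + 1 / 2 * ⟪X z, z⟫

/-- The test function. -/
def testf {d : ℕ} (P : TX d) (X : TX d →L[ℝ] TX d) (t₀ : ℝ) (x₀ : Euc d) (c₁ c₂ : ℝ) (γ : ℝ → ℝ) :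
    ℝ × Euc d → ℝ := fun p => c₁ * quadf P X (WithLp.toLp 2 (p.1 - t₀, p.2 - x₀)) + c₂ * jb p.2 + γ p.1

theorem testf_contDiff {d : ℕ} (P : TX d) (X : TX d →L[ℝ] TX d) (t₀ : ℝ) (x₀ : Euc d) (c₁ c₂ : ℝ) {γ : ℝ → ℝ}
    (hγ : ContDiff ℝ 2 γ) : ContDiff ℝ 2 (testf P X t₀ x₀ c₁ c₂ γ) := by
  unfold testf quadf
  have h1 : ContDiff ℝ 2 (fun p : ℝ × Euc d => (WithLp.toLp 2 (p.1 - t₀, p.2 - x₀) : TX d)) :=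
    ((WithLp.prodContinuousLinearEquiv 2 ℝ ℝ (Euc d)).symm).contDiff.comp
      (by fun_prop : ContDiff ℝ 2 (fun p : ℝ × Euc d => (p.1 - t₀, p.2 - x₀)))
  have h2 := X.contDiff.comp h1 (n := 2)
  have h3 : ContDiff ℝ 2 (fun p : ℝ × Euc d => jb p.2) := jb_contDiff.comp contDiff_snd
  have h4 : ContDiff ℝ 2 (fun p : ℝ × Euc d => γ p.1) := hγ.comp contDiff_fst
  exact ((contDiff_const.mul ((contDiff_const.inner ℝ h1).add (contDiff_const.mul (h2.inner ℝ h1)))).add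
    (contDiff_const.mul h3)).add h4

theorem testf_time {d : ℕ} (P : TX d) (X : TX d →L[ℝ] TX d) (t₀ : ℝ) (x₀ : Euc d) (c₁ c₂ : ℝ) {γ : ℝ → ℝ}
    {γ' : ℝ} (hγ : HasDerivAt γ γ' t₀) : timeDeriv d (testf P X t₀ x₀ c₁ c₂ γ) t₀ x₀ = c₁ * P.fst + γ' := by
  unfold timeDeriv testf
  apply HasDerivAt.deriv
  have e : (fun s => c₁ * quadf P X (WithLp.toLp 2 (s - t₀, x₀ - x₀)) + c₂ * jb x₀ + γ s) =
      fun s => c₁ * ((s - t₀) * P.fst + 1 / 2 * ((s - t₀) ^ 2 * ⟪X (inlX d 1), inlX d 1⟫)) + c₂ * jb x₀ + γ s := by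
    funext s
    have e1 : (WithLp.toLp 2 (s - t₀, x₀ - x₀) : TX d) = (s - t₀) • inlX d 1 := by
      have : (s - t₀) • inlX d 1 = inlX d (s - t₀) := by rw [← map_smul]; simp
      rw [this, sub_self]; rfl
    have e2 : ⟪P, inlX d 1⟫ = P.fst := by
      rw [TX_inner]
      have a : (inlX d 1).fst = 1 := rfl
      have b : (inlX d 1).snd = 0 := rfl
      rw [a, b]; simp
    rw [e1, quadf, map_smul, inner_smul_right, inner_smul_right, inner_smul_left, e2]
    simp only [conj_trivial]
    ring
  simp only
  rw [e]
  have h1 : HasDerivAt (fun s : ℝ => s - t₀) 1 t₀ := (hasDerivAt_id t₀).sub_const t₀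
  have h2 := (((h1.mul_const P.fst).add (((h1.pow 2).mul_const ⟪X (inlX d 1), inlX d 1⟫).const_mul (1/2))).const_mul c₁).add_const (c₂ * jb x₀)
  have h3 := h2.add hγ
  refine h3.congr_deriv ?_
  simp

/-- Space slice. -/
theorem testf_slice {d : ℕ} (P : TX d) (X : TX d →L[ℝ] TX d) (t₀ : ℝ) (x₀ : Euc d) (c₁ c₂ : ℝ) (γ : ℝ → ℝ) (y : Euc d) :
    HasFDerivAt (fun y => testf P X t₀ x₀ c₁ c₂ γ (t₀, y))
      (c₁ • (innerSL ℝ P.snd + (1 / 2 : ℝ) • (((innerSL ℝ (inrX d (y - x₀))).comp (X.comp (inrX d))) +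
          (innerSL ℝ (X (inrX d (y - x₀)))).comp (inrX d))) + c₂ • ((1 / jb y) • innerSL ℝ y)) y := by
  have e : (fun y => testf P X t₀ x₀ c₁ c₂ γ (t₀, y)) =
      fun y => c₁ * (⟪P.snd, y - x₀⟫ + 1 / 2 * ⟪X (inrX d (y - x₀)), inrX d (y - x₀)⟫) + c₂ * jb y + γ t₀ := by
    funext y
    unfold testf
    have e1 : (WithLp.toLp 2 (t₀ - t₀, y - x₀) : TX d) = inrX d (y - x₀) := by
      rw [sub_self]; rfl
    have e2 : ⟪P, inrX d (y - x₀)⟫ = ⟪P.snd, y - x₀⟫ := by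
      rw [TX_inner]
      have a : (inrX d (y - x₀)).fst = 0 := rfl
      have b : (inrX d (y - x₀)).snd = y - x₀ := rfl
      rw [a, b]; simp
    simp only
    rw [e1, quadf, e2]
  rw [e]
  have h0 : HasFDerivAt (fun y : Euc d => y - x₀) (ContinuousLinearMap.id ℝ (Euc d)) y := (hasFDerivAt_id y).sub_const x₀
  have h1 : HasFDerivAt (fun y : Euc d => inrX d (y - x₀)) ((inrX d).comp (ContinuousLinearMap.id ℝ (Euc d))) y :=
    (inrX d).hasFDerivAt.comp y h0
  have h2 : HasFDerivAt (fun y : Euc d => X (inrX d (y - x₀))) (X.comp ((inrX d).comp (ContinuousLinearMap.id ℝ (Euc d)))) y :=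
    X.hasFDerivAt.comp y h1
  have h3 := h2.inner ℝ h1
  have h4 : HasFDerivAt (fun y : Euc d => ⟪P.snd, y - x₀⟫) ((innerSL ℝ P.snd).comp (ContinuousLinearMap.id ℝ (Euc d))) y :=
    (innerSL ℝ P.snd).hasFDerivAt.comp y h0
  have h5 := (((h4.add (h3.const_mul (1/2))).const_mul c₁).add ((jb_hasFDerivAt y).const_mul c₂)).add_const (γ t₀)
  refine h5.congr_fderiv ?_
  ext h
  simp [real_inner_comm, fderivInnerCLM_apply, -WithLp.prod_inner_apply, -map_sub]
  ring

theorem testf_grad {d : ℕ} (P : TX d) (X : TX d →L[ℝ] TX d) (t₀ : ℝ) (x₀ : Euc d) (c₁ c₂ : ℝ) (γ : ℝ → ℝ) :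
    spaceGrad d (testf P X t₀ x₀ c₁ c₂ γ) t₀ x₀ = c₁ • P.snd + (c₂ / jb x₀) • x₀ := by
  unfold spaceGrad spacePartial
  ext i
  rw [(testf_slice P X t₀ x₀ c₁ c₂ γ x₀).fderiv]
  simp [EuclideanSpace.inner_single_right]
  ring

theorem testf_second {d : ℕ} (P : TX d) (X : TX d →L[ℝ] TX d) (t₀ : ℝ) (x₀ : Euc d) (c₁ c₂ : ℝ) (γ : ℝ → ℝ) (c : Euc d) :
    fderiv ℝ (fun y => fderiv ℝ (fun y => testf P X t₀ x₀ c₁ c₂ γ (t₀, y)) y c) x₀ c =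
     c₁ * ⟪X (inrX d c), inrX d c⟫ + c₂ * (‖c‖ ^ 2 / jb x₀ - ⟪x₀, c⟫ ^ 2 / jb x₀ ^ 3) := by
  have e : (fun y => fderiv ℝ (fun y => testf P X t₀ x₀ c₁ c₂ γ (t₀, y)) y c) =
      fun y => c₁ * (⟪P.snd, c⟫ + 1 / 2 * (⟪X (inrX d c), inrX d (y - x₀)⟫ + ⟪X (inrX d (y - x₀)), inrX d c⟫))
        + c₂ * ((jb y)⁻¹ * ⟪c, y⟫) := by
    funext y
    rw [(testf_slice P X t₀ x₀ c₁ c₂ γ y).fderiv]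
    simp [real_inner_comm, -WithLp.prod_inner_apply, -map_sub]
    ring
  rw [e]
  have h0 : HasFDerivAt (fun y : Euc d => y - x₀) (ContinuousLinearMap.id ℝ (Euc d)) x₀ := (hasFDerivAt_id x₀).sub_const x₀
  have h1 : HasFDerivAt (fun y : Euc d => inrX d (y - x₀)) ((inrX d).comp (ContinuousLinearMap.id ℝ (Euc d))) x₀ :=
    (inrX d).hasFDerivAt.comp x₀ h0
  have h2 : HasFDerivAt (fun y : Euc d => X (inrX d (y - x₀))) (X.comp ((inrX d).comp (ContinuousLinearMap.id ℝ (Euc d)))) x₀ :=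
    X.hasFDerivAt.comp x₀ h1
  have h3 := (hasFDerivAt_const (X (inrX d c)) x₀).inner ℝ h1
  have h4 := h2.inner ℝ (hasFDerivAt_const (inrX d c) x₀)
  have h5 : HasFDerivAt (fun y : Euc d => ⟪c, y⟫) (innerSL ℝ c) x₀ := (innerSL ℝ c).hasFDerivAt
  have h6 := (hasDerivAt_inv (jb_pos x₀).ne').comp_hasFDerivAt x₀ (jb_hasFDerivAt x₀)
  have h7 := h6.mul h5
  have h8 := ((((h3.add h4).const_mul (1 / 2)).const_add ⟪P.snd, c⟫).const_mul c₁).add (h7.const_mul c₂)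
  have h9 := h8.fderiv
  refine (congrArg (fun L : Euc d →L[ℝ] ℝ => L c) h9).trans ?_
  have hj := (jb_pos x₀).ne'
  simp [real_inner_comm, fderivInnerCLM_apply]
  field_simp
  ring

theorem testf_op {d n : ℕ} (A : Euc d → Matrix (Fin d) (Fin d) ℝ) (H : Euc d → Euc d → ℝ)
    (S : Matrix (Fin d) (Fin n) ℝ) (P : TX d) (X : TX d →L[ℝ] TX d) (t₀ : ℝ) (x₀ : Euc d) (c₁ c₂ : ℝ) {γ : ℝ → ℝ}
    {γ' : ℝ} (hγ : HasDerivAt γ γ' t₀) (hγ2 : ContDiff ℝ 2 γ) (hA : A x₀ = S * S.transpose) :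
    parabolicOp d A H (testf P X t₀ x₀ c₁ c₂ γ) t₀ x₀ = c₁ * P.fst + γ' -
      ∑ k, (c₁ * ⟪X (inrX d (colv S k)), inrX d (colv S k)⟫ +
        c₂ * (‖colv S k‖ ^ 2 / jb x₀ - ⟪x₀, colv S k⟫ ^ 2 / jb x₀ ^ 3)) +
      H x₀ (c₁ • P.snd + (c₂ / jb x₀) • x₀) := by
  unfold parabolicOp
  rw [testf_time P X t₀ x₀ c₁ c₂ hγ, testf_grad, hA]
  have hcd : ContDiff ℝ 2 (fun y => testf P X t₀ x₀ c₁ c₂ γ (t₀, y)) :=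
    (testf_contDiff P X t₀ x₀ c₁ c₂ hγ2).comp (by fun_prop : ContDiff ℝ 2 (fun y : Euc d => (t₀, y)))
  have hd : DifferentiableAt ℝ (fderiv ℝ (fun y => testf P X t₀ x₀ c₁ c₂ γ (t₀, y))) x₀ :=
    ((hcd.fderiv_right (m := 1) (by norm_num)).differentiable (by norm_num)) x₀
  have h1 := trace_hess S hd
  simp only [testf_second] at h1
  rw [← h1]
  rfl

/-! ### Part 5: viscosity inequalities and the comparison argument -/

theorem sub_ineq {d n : ℕ} {T ΛA : ℝ} {A : Euc d → Matrix (Fin d) (Fin d) ℝ} {H : Euc d → Euc d → ℝ}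
    {U : Set (Euc d)} {v : ℝ × Euc d → ℝ} (hsub : IsViscSubsolution d A H T U v)
    {S : Matrix (Fin d) (Fin n) ℝ} {t₀ : ℝ} {x₀ : Euc d} (hS : A x₀ = S * S.transpose)
    (hSn : matFrobNorm S ≤ ΛA) (ht : t₀ ∈ Ioo 0 T) (hx : x₀ ∈ U) {l K : ℝ} (hl0 : 1 / 2 ≤ l) (hl1 : l < 1)
    {g : ℝ → ℝ} {g' : ℝ} (hg2 : ContDiff ℝ 2 g) (hg : HasDerivAt g g' t₀) (hg0 : 0 ≤ g')
    {P : TX d} {X : TX d →L[ℝ] TX d}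
    (htouch : ∀ᶠ p in nhds (t₀, x₀), l * v p - (1 - l) * (1 / 2 * jb p.2 + K * p.1) - g p.1 ≤
      l * v (t₀, x₀) - (1 - l) * (1 / 2 * jb x₀ + K * t₀) - g t₀ +
        quadf P X (WithLp.toLp 2 (p.1 - t₀, p.2 - x₀))) :
    P.fst + (1 - l) * K - ∑ k, ⟪X (inrX d (colv S k)), inrX d (colv S k)⟫ - (1 - l) / 2 * ΛA ^ 2 +
      l * H x₀ (l⁻¹ • P.snd + (((1 - l) / (2 * l)) / jb x₀) • x₀) ≤ 0 := by
  have hl : 0 < l := by linarith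
  set γ : ℝ → ℝ := fun t => l⁻¹ * ((1 - l) * K * t + g t) with hγ
  have hγd : HasDerivAt γ (l⁻¹ * ((1 - l) * K * 1 + g')) t₀ :=
    (((hasDerivAt_id t₀).const_mul ((1 - l) * K)).add hg).const_mul l⁻¹
  have hγ2 : ContDiff ℝ 2 γ := by
    rw [hγ]; fun_prop
  have h1 := hsub (testf P X t₀ x₀ l⁻¹ ((1 - l) / (2 * l)) γ) (testf_contDiff P X t₀ x₀ _ _ hγ2) t₀ ht x₀ hx (by
    apply IsLocalMax.on
    filter_upwards [htouch] with p hp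
    have q0 : quadf P X (WithLp.toLp 2 (t₀ - t₀, x₀ - x₀)) = 0 := by
      have : (WithLp.toLp 2 (t₀ - t₀, x₀ - x₀) : TX d) = 0 := by simp
      rw [this]; simp [quadf]
    simp only [testf, q0]
    have e1 : ∀ (a b q t : ℝ), a - (l⁻¹ * q + (1 - l) / (2 * l) * b + l⁻¹ * t) =
        l⁻¹ * (l * a - q - (1 - l) * (1 / 2 * b) - t) := by
      intro a b q t; field_simp; ring
    simp only [hγ]
    rw [e1, e1]
    apply mul_le_mul_of_nonneg_left _ (inv_nonneg.2 hl.le)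
    linarith)
  rw [testf_op A H S P X t₀ x₀ _ _ hγd hγ2 hS] at h1
  have h2 : ∑ k, (l⁻¹ * ⟪X (inrX d (colv S k)), inrX d (colv S k)⟫ +
        (1 - l) / (2 * l) * (‖colv S k‖ ^ 2 / jb x₀ - ⟪x₀, colv S k⟫ ^ 2 / jb x₀ ^ 3)) ≤
      l⁻¹ * ∑ k, ⟪X (inrX d (colv S k)), inrX d (colv S k)⟫ + (1 - l) / (2 * l) * ΛA ^ 2 := by
    rw [Finset.sum_add_distrib, ← Finset.mul_sum, ← Finset.mul_sum]
    have h3 : ∑ k, (‖colv S k‖ ^ 2 / jb x₀ - ⟪x₀, colv S k⟫ ^ 2 / jb x₀ ^ 3) ≤ ∑ k, ‖colv S k‖ ^ 2 := by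
      apply Finset.sum_le_sum
      intro k _
      have a1 : ‖colv S k‖ ^ 2 / jb x₀ ≤ ‖colv S k‖ ^ 2 := div_le_self (by positivity) (jb_ge_one x₀)
      have a2 : 0 ≤ ⟪x₀, colv S k⟫ ^ 2 / jb x₀ ^ 3 := by
        have := jb_pos x₀
        positivity
      linarith
    rw [colv_norm] at h3
    have h4 : matFrobNorm S ^ 2 ≤ ΛA ^ 2 := pow_le_pow_left₀ (Real.sqrt_nonneg _) hSn 2
    have h5 : 0 ≤ (1 - l) / (2 * l) := div_nonneg (by linarith) (by linarith)
    have := mul_le_mul_of_nonneg_left (h3.trans h4) h5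
    linarith
  have h6 : l * (l⁻¹ * P.fst + l⁻¹ * ((1 - l) * K * 1 + g') - (l⁻¹ * ∑ k, ⟪X (inrX d (colv S k)), inrX d (colv S k)⟫ + (1 - l) / (2 * l) * ΛA ^ 2) +
      H x₀ (l⁻¹ • P.snd + ((1 - l) / (2 * l) / jb x₀) • x₀)) ≤ 0 :=
    mul_nonpos_of_nonneg_of_nonpos hl.le (by linarith)
  have h7 : l * (l⁻¹ * P.fst + l⁻¹ * ((1 - l) * K * 1 + g') - (l⁻¹ * ∑ k, ⟪X (inrX d (colv S k)), inrX d (colv S k)⟫ + (1 - l) / (2 * l) * ΛA ^ 2) +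
      H x₀ (l⁻¹ • P.snd + ((1 - l) / (2 * l) / jb x₀) • x₀)) = P.fst + ((1 - l) * K + g') - ∑ k, ⟪X (inrX d (colv S k)), inrX d (colv S k)⟫ - (1 - l) / 2 * ΛA ^ 2 + l *
      H x₀ (l⁻¹ • P.snd + ((1 - l) / (2 * l) / jb x₀) • x₀) := by
    field_simp
    ring
  linarith

theorem super_ineq {d n : ℕ} {T : ℝ} {A : Euc d → Matrix (Fin d) (Fin d) ℝ} {H : Euc d → Euc d → ℝ}
    {U : Set (Euc d)} {w : ℝ × Euc d → ℝ} (hsup : IsViscSupersolution d A H T U w)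
    {S : Matrix (Fin d) (Fin n) ℝ} {t₀ : ℝ} {x₀ : Euc d} (hS : A x₀ = S * S.transpose)
    (ht : t₀ ∈ Ioo 0 T) (hx : x₀ ∈ U)
    {Q : TX d} {Y : TX d →L[ℝ] TX d}
    (htouch : ∀ᶠ p in nhds (t₀, x₀), - w p ≤ - w (t₀, x₀) +
        quadf Q Y (WithLp.toLp 2 (p.1 - t₀, p.2 - x₀))) :
    0 ≤ - Q.fst + ∑ k, ⟪Y (inrX d (colv S k)), inrX d (colv S k)⟫ + H x₀ (- Q.snd) := by
  have hγ2 : ContDiff ℝ 2 (fun _ : ℝ => (0 : ℝ)) := contDiff_const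
  have h1 := hsup (testf Q Y t₀ x₀ (-1) 0 (fun _ => 0)) (testf_contDiff Q Y t₀ x₀ _ _ hγ2) t₀ ht x₀ hx (by
    apply IsLocalMin.on
    filter_upwards [htouch] with p hp
    have q0 : quadf Q Y (WithLp.toLp 2 (t₀ - t₀, x₀ - x₀)) = 0 := by
      have : (WithLp.toLp 2 (t₀ - t₀, x₀ - x₀) : TX d) = 0 := by simp
      rw [this]; simp [quadf]
    simp only [testf, q0]
    linarith)
  rw [testf_op A H S Q Y t₀ x₀ _ _ (hasDerivAt_const t₀ (0 : ℝ)) hγ2 hS] at h1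
  simp only [zero_mul, add_zero, zero_div, zero_smul, neg_mul, one_mul, neg_smul, one_smul, Finset.sum_neg_distrib, sub_neg_eq_add] at h1
  exact h1

theorem TX_fst_le {d : ℕ} (z : TX d) : |z.fst| ≤ ‖z‖ := by
  have h := WithLp.prod_norm_sq_eq_of_L2 z
  have h2 : ‖z.fst‖ ^ 2 ≤ ‖z‖ ^ 2 := by rw [h]; nlinarith [sq_nonneg ‖z.snd‖]
  exact (sq_le_sq₀ (norm_nonneg _) (norm_nonneg _)).1 h2

theorem TX_snd_le {d : ℕ} (z : TX d) : ‖z.snd‖ ≤ ‖z‖ := by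
  have h := WithLp.prod_norm_sq_eq_of_L2 z
  have h2 : ‖z.snd‖ ^ 2 ≤ ‖z‖ ^ 2 := by rw [h]; nlinarith [sq_nonneg ‖z.fst‖]
  exact (sq_le_sq₀ (norm_nonneg _) (norm_nonneg _)).1 h2

theorem touch_ev {d : ℕ} {K O : Set (TX d)} (hO : IsOpen O) (hOK : O ⊆ K) {ζ : TX d} (hζ : ζ ∈ O)
    {f : ℝ × Euc d → ℝ} {P : TX d} {X : TX d →L[ℝ] TX d}
    (h : ∃ s > 0, ∀ ζ' ∈ K, ‖ζ' - ζ‖ ≤ s →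
      f ζ'.ofLp ≤ f ζ.ofLp + ⟪P, ζ' - ζ⟫ + 1/2*⟪X (ζ' - ζ), ζ' - ζ⟫) :
    ∀ᶠ p in nhds (ζ.fst, ζ.snd), f p ≤ f (ζ.fst, ζ.snd) +
        quadf P X (WithLp.toLp 2 (p.1 - ζ.fst, p.2 - ζ.snd)) := by
  obtain ⟨s, hs, h⟩ := h
  have hc : Continuous (fun p : ℝ × Euc d => (WithLp.toLp 2 p : TX d)) :=
    (WithLp.prodContinuousLinearEquiv 2 ℝ ℝ (Euc d)).symm.continuous
  have hn : O ∩ closedBall ζ s ∈ nhds ((fun p : ℝ × Euc d => (WithLp.toLp 2 p : TX d)) (ζ.fst, ζ.snd)) :=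
    Filter.inter_mem (hO.mem_nhds hζ) (closedBall_mem_nhds ζ hs)
  filter_upwards [hc.continuousAt hn] with p hp
  have h1 := h (WithLp.toLp 2 p) (hOK hp.1) (by simpa [dist_eq_norm] using hp.2)
  rw [add_assoc] at h1
  exact h1

set_option maxHeartbeats 1000000 in
theorem core {d : ℕ} (hd : 0 < d) {T T' : ℝ} (hT' : T' ≤ T)
    {ΛA : ℝ} {A : Euc d → Matrix (Fin d) (Fin d) ℝ} (hA : CondA d ΛA A)
    {m Λ : ℝ} (hm : 1 < m) (hΛ : 0 < Λ)
    {a M : ℝ → ℝ} (haM : GoodFamilies a M)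
    {H : Euc d → Euc d → ℝ} (hH : MemH d m Λ a M H)
    {I : Type} (hI : Nonempty I) {mi : I → ℝ} (hmi : ∀ i, 1 < mi i)
    {Hi : I → Euc d → Euc d → ℝ} (hHi : ∀ i, MemB d (mi i) Λ a M (Hi i))
    (hinf : ∀ x p : Euc d, H x p = ⨅ i, Hi i x p)
    {U : Set (Euc d)} (hU : IsOpen U)
    {v w w' : ℝ × Euc d → ℝ}
    (hsub : IsViscSubsolution d A H T U v)
    (hsup : IsViscSupersolution d A H T U w)
    {l K R : ℝ} (hl0 : 1 / 2 ≤ l) (hl1 : l < 1) (hK : ΛA ^ 2 / 2 + 2 * Λ + 3 / 2 ≤ K) (hR : 0 < R)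
    {g g' : ℝ → ℝ} (hg2 : ContDiff ℝ 2 g) (hg : ∀ t, HasDerivAt g (g' t) t) (hg0 : ∀ t, 0 ≤ g' t)
    (hww : ∀ t ∈ Icc 0 T', ∀ x ∈ U, w' (t, x) = w (t, x))
    (hu1 : UpperSemicontinuousOn (fun p : ℝ × Euc d => l * v p - (1 - l) * (1 / 2 * jb p.2 + K * p.1) - g p.1)
      (Icc 0 T' ×ˢ (closure U ∩ closedBall 0 R)))
    (hu2 : UpperSemicontinuousOn (fun p : ℝ × Euc d => - w' p) (Icc 0 T' ×ˢ (closure U ∩ closedBall 0 R)))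
    {b : ℝ}
    (hb : ∀ t ∈ Icc 0 T', ∀ x ∈ closure U ∩ closedBall 0 R, ¬ (t ∈ Ioo 0 T' ∧ x ∈ U ∩ ball 0 R) →
      (l * v (t, x) - (1 - l) * (1 / 2 * jb x + K * t) - g t) + - w' (t, x) ≤ b)
    {ts : ℝ} {xs : Euc d} (hts : ts ∈ Icc 0 T') (hxs : xs ∈ closure U ∩ closedBall 0 R)
    (hs : b < (l * v (ts, xs) - (1 - l) * (1 / 2 * jb xs + K * ts) - g ts) + - w' (ts, xs)) : False := by
  set f : ℝ × Euc d → ℝ := fun p => l * v p - (1 - l) * (1 / 2 * jb p.2 + K * p.1) - g p.1 with hf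
  obtain ⟨n, σ, hσ, hσb, hσL⟩ := hA
  have hl : 0 < l := by linarith
  set KK : Set (TX d) := {ζ | ζ.ofLp ∈ Icc 0 T' ×ˢ (closure U ∩ closedBall 0 R)} with hKK
  set OO : Set (TX d) := {ζ | ζ.ofLp ∈ Ioo 0 T' ×ˢ (U ∩ ball 0 R)} with hOO
  have hco : Continuous (fun ζ : TX d => ζ.ofLp) := (WithLp.prodContinuousLinearEquiv 2 ℝ ℝ (Euc d)).continuous
  have hKc : IsCompact KK := by
    have h1 : IsCompact (Icc 0 T' ×ˢ (closure U ∩ closedBall (0 : Euc d) R)) :=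
      isCompact_Icc.prod ((isCompact_closedBall _ _).inter_left isClosed_closure)
    exact (WithLp.prodContinuousLinearEquiv 2 ℝ ℝ (Euc d)).toHomeomorph.isClosedEmbedding.isCompact_preimage h1
  have hOo : IsOpen OO := (isOpen_Ioo.prod (hU.inter isOpen_ball)).preimage hco
  have hOK : OO ⊆ KK := fun ζ hζ => ⟨Ioo_subset_Icc_self hζ.1, subset_closure hζ.2.1, ball_subset_closedBall hζ.2.2⟩
  have hU1 : UpperSemicontinuousOn (fun ζ : TX d => f ζ.ofLp) KK := hu1.comp hco.continuousOn (fun ζ hζ => hζ)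
  have hU2 : UpperSemicontinuousOn (fun ζ : TX d => - w' ζ.ofLp) KK := hu2.comp hco.continuousOn (fun ζ hζ => hζ)
  obtain ⟨τ0, hτ0, hham⟩ := ham_main hd hm hΛ haM hH hI hmi hHi hinf (r := R + 1) (by linarith) hl0 hl1
  obtain ⟨τ, hτ, hττ, hτA⟩ : ∃ τ > 0, τ ≤ τ0 ∧ ΛA ^ 2 * τ ≤ (1 - l) / 4 := by
    refine ⟨min τ0 ((1 - l) / 4 / (ΛA ^ 2 + 1)), lt_min hτ0 (by apply div_pos <;> nlinarith), min_le_left _ _, ?_⟩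
    have h1 := min_le_right τ0 ((1 - l) / 4 / (ΛA ^ 2 + 1))
    have h2 : 0 ≤ (1 - l) / 4 / (ΛA ^ 2 + 1) := by apply div_nonneg <;> nlinarith
    have h3 : (ΛA ^ 2 + 1) * ((1 - l) / 4 / (ΛA ^ 2 + 1)) = (1 - l) / 4 := by
      have : ΛA ^ 2 + 1 ≠ 0 := by positivity
      field_simp
    nlinarith [sq_nonneg ΛA]
  have hsK : (WithLp.toLp 2 (ts, xs) : TX d) ∈ KK := ⟨hts, hxs⟩
  obtain ⟨δ, hδ, τ', hτ', hpen⟩ := penalization hKc hOo hU1 hU2 (b := b)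
    (fun ζ hζ => hb ζ.fst hζ.1.1 ζ.snd hζ.1.2 (fun h => hζ.2 ⟨h.1, h.2⟩)) hsK hs hτ
  obtain ⟨P0, hsums⟩ := sums hKc ⟨_, hsK⟩ hU1 hU2 hδ
  set C : ℝ := 2 * ΛA ^ 2 + 2 + 2 * (Λ * (2 * ‖P0‖ + 3) ^ (m - 1)) with hC
  have hCpos : 0 < C := by positivity
  obtain ⟨ρ, hρ, hρ1, hρτ, hρC⟩ : ∃ ρ > 0, ρ ≤ 1 ∧ ρ ≤ τ' ∧ ρ * C ≤ (1 - l) / 4 := by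
    refine ⟨min (min 1 τ') ((1 - l) / 4 / C), lt_min (lt_min one_pos hτ') (by apply div_pos <;> linarith),
      (min_le_left _ _).trans (min_le_left _ _), (min_le_left _ _).trans (min_le_right _ _), ?_⟩
    rw [← le_div_iff₀ hCpos]
    exact min_le_right _ _
  obtain ⟨ζ, hζ, η, hη, P, Q, X, Y, hP, hQ, hopt, hmat, hX, hY⟩ := hsums ρ hρ
  obtain ⟨hζO, hηO, hdist, hdist2⟩ := hpen ζ hζ η hη (fun ζ' h1 η' h2 => (hopt ζ' h1 η' h2).trans (by linarith))
  have hev1 := touch_ev hOo hOK hζO (f := f) hX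
  have hev2 := touch_ev hOo hOK hηO (f := fun p => - w' p) hY
  have hev2' : ∀ᶠ p in nhds (η.fst, η.snd), - w p ≤ - w (η.fst, η.snd) +
        quadf Q Y (WithLp.toLp 2 (p.1 - η.fst, p.2 - η.snd)) := by
    have hn : Ioo 0 T' ×ˢ (U ∩ ball 0 R) ∈ nhds (η.fst, η.snd) :=
      (isOpen_Ioo.prod (hU.inter isOpen_ball)).mem_nhds ⟨hηO.1, hηO.2⟩
    filter_upwards [hev2, hn] with p hp hpn
    have e1 := hww p.1 (Ioo_subset_Icc_self hpn.1) p.2 hpn.2.1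
    have e2 := hww η.fst (Ioo_subset_Icc_self hηO.1) η.snd hηO.2.1
    rw [e2] at hp
    have e1 : w' p = w p := e1
    rw [e1] at hp
    exact hp
  have hTT : Ioo 0 T' ⊆ Ioo 0 T := Ioo_subset_Ioo_right hT'
  have i1 := sub_ineq hsub (hσ ζ.snd) (hσb ζ.snd) (hTT hζO.1) hζO.2.1 hl0 hl1 hg2 (hg ζ.fst) (hg0 ζ.fst) hev1
  have i2 := super_ineq hsup (hσ η.snd) (hTT hηO.1) hηO.2.1 hev2'
  have hfst : ∀ z : TX d, |z.fst| ≤ ‖z‖ := TX_fst_le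
  have hsnd : ∀ z : TX d, ‖z.snd‖ ≤ ‖z‖ := TX_snd_le
  set x := ζ.snd with hx
  set y := η.snd with hy
  have hxy : ‖x - y‖ ≤ ‖ζ - η‖ := hsnd (ζ - η)
  -- matrix part
  have j1 : ∑ k, ⟪X (inrX d (colv (σ x) k)), inrX d (colv (σ x) k)⟫ + ∑ k, ⟪Y (inrX d (colv (σ y) k)), inrX d (colv (σ y) k)⟫
      ≤ (1 - l) / 4 + 2 * ρ * ΛA ^ 2 := by
    have k1 : ∀ k, ⟪X (inrX d (colv (σ x) k)), inrX d (colv (σ x) k)⟫ + ⟪Y (inrX d (colv (σ y) k)), inrX d (colv (σ y) k)⟫ ≤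
        ‖colv (σ x - σ y) k‖ ^ 2 / δ + ρ * (‖colv (σ x) k‖ ^ 2 + ‖colv (σ y) k‖ ^ 2) := by
      intro k
      have := hmat (inrX d (colv (σ x) k)) (inrX d (colv (σ y) k))
      rwa [← map_sub, inrX_norm, inrX_norm, inrX_norm, ← colv_sub] at this
    have k2 := Finset.sum_le_sum (s := Finset.univ) (fun k _ => k1 k)
    rw [Finset.sum_add_distrib, Finset.sum_add_distrib, ← Finset.sum_div, ← Finset.mul_sum, Finset.sum_add_distrib,
      colv_norm, colv_norm, colv_norm] at k2
    have k3 : matFrobNorm (σ x - σ y) ^ 2 ≤ (ΛA * ‖x - y‖) ^ 2 := pow_le_pow_left₀ (Real.sqrt_nonneg _) (hσL x y) 2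
    have k4 : matFrobNorm (σ x) ^ 2 ≤ ΛA ^ 2 := pow_le_pow_left₀ (Real.sqrt_nonneg _) (hσb x) 2
    have k5 : matFrobNorm (σ y) ^ 2 ≤ ΛA ^ 2 := pow_le_pow_left₀ (Real.sqrt_nonneg _) (hσb y) 2
    have k6 : matFrobNorm (σ x - σ y) ^ 2 / δ ≤ ΛA ^ 2 * τ := by
      calc matFrobNorm (σ x - σ y) ^ 2 / δ ≤ (ΛA ^ 2 * ‖ζ - η‖ ^ 2) / δ := by
            apply div_le_div_of_nonneg_right _ hδ.le
            calc _ ≤ (ΛA * ‖x - y‖) ^ 2 := k3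
              _ = ΛA ^ 2 * ‖x - y‖ ^ 2 := by ring
              _ ≤ _ := by gcongr
        _ = ΛA ^ 2 * (‖ζ - η‖ ^ 2 / δ) := by ring
        _ ≤ _ := by gcongr
    nlinarith
  -- gradient part
  have hpP : ‖P.snd‖ ≤ ‖P0‖ + 1 := by
    have h1 := hsnd (P - P0)
    have h2 : (P - P0).snd = P.snd - P0.snd := rfl
    have h3 := norm_le_norm_add_norm_sub' P.snd P0.snd
    have h4 := hsnd P0
    rw [h2] at h1
    linarith
  have hpQ : ‖- Q.snd‖ ≤ ‖P0‖ + 1 := by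
    have h1 := hsnd (Q + P0)
    have h2 : (Q + P0).snd = Q.snd + P0.snd := rfl
    have h3 := norm_sub_le (Q.snd + P0.snd) P0.snd
    rw [add_sub_cancel_right] at h3
    have h4 := hsnd P0
    rw [h2] at h1
    rw [norm_neg]
    linarith
  have hpPQ : ‖P + Q‖ ≤ 2 * ρ := by
    have h1 := norm_add_le (P - P0) (Q + P0)
    have h2 : P - P0 + (Q + P0) = P + Q := by abel
    rw [h2] at h1
    linarith
  have j2 : H y P.snd ≥ H y (- Q.snd) - Λ * (2 * ‖P0‖ + 3) ^ (m - 1) * (2 * ρ) := by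
    have h1 := hH.1 y P.snd (- Q.snd)
    have h2 : ‖P.snd - -Q.snd‖ ≤ 2 * ρ := by
      rw [sub_neg_eq_add]
      exact (hsnd (P + Q)).trans hpPQ
    have h3 : (‖P.snd‖ + ‖- Q.snd‖ + 1) ^ (m - 1) ≤ (2 * ‖P0‖ + 3) ^ (m - 1) := by
      apply Real.rpow_le_rpow (by positivity) (by linarith) (by linarith)
    have h4 : Λ * (‖P.snd‖ + ‖- Q.snd‖ + 1) ^ (m - 1) * ‖P.snd - -Q.snd‖ ≤ Λ * (2 * ‖P0‖ + 3) ^ (m - 1) * (2 * ρ) := by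
      gcongr
    have h5 := abs_le.1 (h1.trans h4)
    linarith [h5.1]
  have j3 : -(2 * ρ) ≤ P.fst + Q.fst := by
    have h1 := (hfst (P + Q)).trans hpPQ
    exact (abs_le.1 h1).1
  -- Hamiltonian
  have j4 : H y P.snd ≤ l * H x (l⁻¹ • P.snd + (((1 - l) / (2 * l)) / jb x) • x) + (2 * Λ + 1 / 2) * (1 - l) := by
    have hj := jb_pos x
    have h1 := hham x (ball_subset_ball (by linarith) hζO.2.2) y (ball_subset_ball (by linarith) hηO.2.2)
      (hxy.trans (hdist.trans hττ)) (l⁻¹ • P.snd + (((1 - l) / (2 * l)) / jb x) • x) ((-(1 / (2 * jb x))) • x) (by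
        rw [norm_smul, norm_neg, Real.norm_of_nonneg (by positivity)]
        have := jb_ge_norm x
        rw [div_mul_eq_mul_div, div_le_iff₀ (by positivity)]
        linarith)
    have h2 : l • (l⁻¹ • P.snd + (((1 - l) / (2 * l)) / jb x) • x) + (1 - l) • ((-(1 / (2 * jb x))) • x) = P.snd := by
      rw [smul_add, smul_smul, smul_smul, smul_smul, mul_inv_cancel₀ hl.ne', one_smul, add_assoc, ← add_smul]
      have : l * ((1 - l) / (2 * l) / jb x) + (1 - l) * -(1 / (2 * jb x)) = 0 := by
        field_simp
        ring
      rw [this, zero_smul, add_zero]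
    rwa [h2] at h1
  have hfin : (1 - l) * (ΛA ^ 2 / 2 + 2 * Λ + 3 / 2) ≤ (1 - l) * K := mul_le_mul_of_nonneg_left hK (by linarith)
  rw [hC] at hρC
  linarith

theorem usc_u {d : ℕ} {l K : ℝ} (hl : 0 ≤ l) {v : ℝ × Euc d → ℝ} {s : Set (ℝ × Euc d)}
    (hv : UpperSemicontinuousOn v s) {g : ℝ → ℝ} (hg : Continuous g) :
    UpperSemicontinuousOn (fun p : ℝ × Euc d => l * v p - (1 - l) * (1 / 2 * jb p.2 + K * p.1) - g p.1) s := by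
  have h1 : UpperSemicontinuousOn (fun p => l * v p) s :=
    (continuous_const_mul l).comp_upperSemicontinuousOn hv (fun a b h => mul_le_mul_of_nonneg_left h hl)
  have hj : Continuous (fun p : ℝ × Euc d => jb p.2) := (jb_contDiff (n := 0)).continuous.comp continuous_snd
  have h2 : Continuous (fun p : ℝ × Euc d => -((1 - l) * (1 / 2 * jb p.2 + K * p.1)) - g p.1) := by
    fun_prop
  have h3 := h1.add (h2.continuousOn (s := s)).upperSemicontinuousOn
  have e : (fun p : ℝ × Euc d => l * v p - (1 - l) * (1 / 2 * jb p.2 + K * p.1) - g p.1) =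
      fun p => l * v p + (-((1 - l) * (1 / 2 * jb p.2 + K * p.1)) - g p.1) := by
    funext p; ring
  rw [e]
  exact h3

theorem lower_bd {d : ℕ} {T : ℝ} {U : Set (Euc d)} {w : ℝ × Euc d → ℝ}
    (hw : LowerSemicontinuousOn w (Icc 0 T ×ˢ closure U)) (hgw : SublinearBelow d T U w) :
    ∃ C ≥ 0, ∀ t ∈ Icc 0 T, ∀ x ∈ U, -(1 / 4 * (1 + ‖x‖)) - C ≤ w (t, x) := by
  obtain ⟨R, hR⟩ := hgw (1 / 4) (by norm_num)
  have hc : IsCompact (Icc 0 T ×ˢ (closure U ∩ closedBall (0 : Euc d) R)) :=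
    isCompact_Icc.prod ((isCompact_closedBall _ _).inter_left isClosed_closure)
  obtain ⟨B, hB⟩ := (hw.mono (prod_mono_right inter_subset_left)).bddBelow_of_isCompact hc
  refine ⟨|B|, abs_nonneg B, fun t ht x hx => ?_⟩
  by_cases h : R ≤ ‖x‖
  · have := hR x hx h t ht
    linarith [abs_nonneg B]
  · have h1 : B ≤ w (t, x) := hB ⟨(t, x), ⟨ht, subset_closure hx, by simpa using (not_le.1 h).le⟩, rfl⟩
    have h2 := neg_abs_le B
    have := norm_nonneg x
    linarith

/-- **Comparison principle for infima of convex Hamiltonians** (Theorem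
`teo parabolic comp`): if `H ∈ ℋ(m,Λ,(a_r),(M_r))` is the pointwise infimum of a family
`H_i ∈ 𝔅(m_i,Λ,(a_r),(M_r))`, then comparison between semicontinuous sub/supersolutions
with sublinear growth holds up to the parabolic boundary. -/
theorem statement13 (d : ℕ) (hd : 0 < d) (T : ℝ) (hT : 0 < T)
    (ΛA : ℝ) (hΛA : 0 < ΛA) (A : Euc d → Matrix (Fin d) (Fin d) ℝ) (hA : CondA d ΛA A)
    (m Λ : ℝ) (hm : 1 < m) (hΛ : 0 < Λ)
    (a M : ℝ → ℝ) (haM : GoodFamilies a M)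
    (H : Euc d → Euc d → ℝ) (hH : MemH d m Λ a M H)
    (I : Type) (hI : Nonempty I) (mi : I → ℝ) (hmi : ∀ i, 1 < mi i)
    (Hi : I → Euc d → Euc d → ℝ) (hHi : ∀ i, MemB d (mi i) Λ a M (Hi i))
    (hinf : ∀ x p : Euc d, H x p = ⨅ i, Hi i x p)
    (U : Set (Euc d)) (hU : IsOpen U)
    (v w : ℝ × Euc d → ℝ)
    (hv : UpperSemicontinuousOn v (Icc 0 T ×ˢ closure U))
    (hw : LowerSemicontinuousOn w (Icc 0 T ×ˢ closure U))
    (hsub : IsViscSubsolution d A H T U v)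
    (hsup : IsViscSupersolution d A H T U w)
    (hgv : SublinearAbove d T U v) (hgw : SublinearBelow d T U w)
    (c : ℝ) (hc : ∀ p ∈ parabolicBoundary d T U, v p - w p ≤ c) :
    ∀ t ∈ Ioo (0 : ℝ) T, ∀ x ∈ U, v (t, x) - w (t, x) ≤ c := by
  intro ts hts xs hxs
  by_contra hcon
  push Not at hcon
  obtain ⟨C1, hC1, hlow⟩ := lower_bd hw hgw
  set w' : ℝ × Euc d → ℝ := fun p => max (w p) (-(1 / 4 * (1 + ‖p.2‖)) - C1) with hw'
  have hww : ∀ t ∈ Icc 0 T, ∀ x ∈ U, w' (t, x) = w (t, x) := fun t ht x hx => max_eq_left (hlow t ht x hx)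
  have hw'1 : ∀ p, w p ≤ w' p := fun p => le_max_left _ _
  have hw'2 : ∀ t x, -(1 / 4 * (1 + ‖x‖)) - C1 ≤ w' (t, x) := fun t x => le_max_right _ _
  have hnw : UpperSemicontinuousOn (fun p => - w' p) (Icc 0 T ×ˢ closure U) := by
    have hcont : Continuous (fun p : ℝ × Euc d => -(1 / 4 * (1 + ‖p.2‖)) - C1) := by fun_prop
    exact continuous_neg.comp_lowerSemicontinuousOn_antitone (hw.sup (hcont.continuousOn.lowerSemicontinuousOn))
      (fun a b h => neg_le_neg h)
  set K : ℝ := ΛA ^ 2 / 2 + 2 * Λ + 3 / 2 with hK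
  have hK0 : 0 ≤ K := by positivity
  set D : ℝ := v (ts, xs) - w (ts, xs) - c with hD
  have hDpos : 0 < D := by linarith
  -- choice of `l`
  obtain ⟨l, hl0, hl1, hlD⟩ : ∃ l : ℝ, 1 / 2 ≤ l ∧ l < 1 ∧
      (1 - l) * (v (ts, xs) - c + 1 / 2 * jb xs + K * ts + C1 + 1) ≤ D / 2 := by
    set E : ℝ := v (ts, xs) - c + 1 / 2 * jb xs + K * ts + C1 + 1 with hE
    have hEp : 0 < |E| + 1 := by positivity
    have h1 : 0 < min (1 / 2) (D / 2 / (|E| + 1)) := lt_min (by norm_num) (by positivity)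
    refine ⟨1 - min (1 / 2) (D / 2 / (|E| + 1)), ?_, by linarith, ?_⟩
    · have := min_le_left (1 / 2) (D / 2 / (|E| + 1))
      linarith
    · rw [sub_sub_cancel]
      calc min (1 / 2) (D / 2 / (|E| + 1)) * E ≤ min (1 / 2) (D / 2 / (|E| + 1)) * (|E| + 1) :=
            mul_le_mul_of_nonneg_left (by linarith [le_abs_self E]) h1.le
        _ ≤ (D / 2 / (|E| + 1)) * (|E| + 1) := mul_le_mul_of_nonneg_right (min_le_right _ _) hEp.le
        _ = D / 2 := by field_simp
  have hl : 0 < l := by linarith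
  set b : ℝ := l * c + (1 - l) * (C1 + 1) with hb
  -- parabolic boundary
  have hbdry : ∀ t ∈ Icc 0 T, ∀ x, (t, x) ∈ parabolicBoundary d T U → ∀ γ : ℝ, 0 ≤ γ →
      (l * v (t, x) - (1 - l) * (1 / 2 * jb x + K * t) - γ) + - w' (t, x) ≤ b := by
    intro t ht x hx γ hγ
    have h1 := hc _ hx
    have h2 := hw'1 (t, x)
    have h3 := hw'2 t x
    have h4 := jb_ge_norm x
    have h5 := norm_nonneg x
    have h6 : 0 ≤ K * t := mul_nonneg hK0 ht.1
    have h7 : l * (v (t, x) - w' (t, x)) ≤ l * c := mul_le_mul_of_nonneg_left (by linarith) hl.le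
    have h8 : (1 - l) * (- w' (t, x) - 1 / 2 * jb x - K * t) ≤ (1 - l) * (C1 + 1) :=
      mul_le_mul_of_nonneg_left (by linarith) (by linarith)
    rw [hb]
    linarith
  -- growth
  obtain ⟨R1, hR1⟩ := hgv ((1 - l) / 8) (by linarith)
  obtain ⟨R2, hR2⟩ := hgw ((1 - l) / 8) (by linarith)
  set R : ℝ := max (max R1 R2) (max (‖xs‖ + 1) (1 + 4 * |b| / (1 - l))) with hR
  have hR1' : R1 ≤ R := (le_max_left _ _).trans (le_max_left _ _)
  have hR2' : R2 ≤ R := (le_max_right _ _).trans (le_max_left _ _)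
  have hR3 : ‖xs‖ + 1 ≤ R := (le_max_left _ _).trans (le_max_right _ _)
  have hR4 : 1 + 4 * |b| / (1 - l) ≤ R := (le_max_right _ _).trans (le_max_right _ _)
  have hRpos : 0 < R := by linarith [norm_nonneg xs]
  have hgrow : ∀ t ∈ Icc 0 T, ∀ x ∈ U, R ≤ ‖x‖ → ∀ γ : ℝ, 0 ≤ γ →
      (l * v (t, x) - (1 - l) * (1 / 2 * jb x + K * t) - γ) + - w' (t, x) ≤ b := by
    intro t ht x hx hRx γ hγ
    rw [hww t ht x hx]
    have h1 := hR1 x hx (hR1'.trans hRx) t ht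
    have h2 := hR2 x hx (hR2'.trans hRx) t ht
    have h4 := jb_ge_norm x
    have h5 := norm_nonneg x
    have h6 : 0 ≤ K * t := mul_nonneg hK0 ht.1
    have h7 : l * v (t, x) ≤ (1 - l) / 8 * (1 + ‖x‖) := by
      have e1 : l * v (t, x) ≤ l * ((1 - l) / 8 * (1 + ‖x‖)) := mul_le_mul_of_nonneg_left h1 hl.le
      have e2 : 0 ≤ (1 - l) / 8 * (1 + ‖x‖) := mul_nonneg (by linarith) (by linarith)
      nlinarith
    have h8 : (1 - l) * (1 / 2 * ‖x‖) ≤ (1 - l) * (1 / 2 * jb x + K * t) :=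
      mul_le_mul_of_nonneg_left (by linarith) (by linarith)
    have h9 : 4 * |b| / (1 - l) ≤ ‖x‖ - 1 := by linarith
    rw [div_le_iff₀ (by linarith)] at h9
    have := neg_abs_le b
    linarith
  -- times
  set T' : ℝ := (ts + T) / 2 with hT'
  have hT1 : ts < T' := by linarith [hts.2]
  have hT2 : T' < T := by linarith [hts.2]
  set κ : ℝ := (T' - ts) / 2 with hκ
  have hκ0 : 0 < κ := by linarith
  have hsubset : Icc 0 T' ×ˢ (closure U ∩ closedBall (0 : Euc d) R) ⊆ Icc 0 T ×ˢ closure U :=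
    prod_mono (Icc_subset_Icc_right hT2.le) inter_subset_left
  have hcomp : IsCompact (Icc 0 T' ×ˢ (closure U ∩ closedBall (0 : Euc d) R)) :=
    isCompact_Icc.prod ((isCompact_closedBall _ _).inter_left isClosed_closure)
  obtain ⟨S, hS⟩ := ((usc_u (K := K) hl.le (hv.mono hsubset) (continuous_const (y := (0 : ℝ)))).add
    (hnw.mono hsubset)).bddAbove_of_isCompact hcomp
  set Y : ℝ := |S - b| + 2 / D + 1 with hY
  have hY0 : 0 < Y := by positivity
  set L : ℝ := Y / κ with hL
  have hL0 : 0 < L := by positivity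
  set g : ℝ → ℝ := fun t => Real.exp (L * (t - (ts + κ))) with hg
  have hgpos : ∀ t, 0 ≤ g t := fun t => (Real.exp_pos _).le
  have hgd : ∀ t, HasDerivAt g (Real.exp (L * (t - (ts + κ))) * (L * 1)) t := fun t =>
    (((hasDerivAt_id t).sub_const (ts + κ)).const_mul L).exp
  have hg2 : ContDiff ℝ 2 g := by rw [hg]; fun_prop
  have hgT : S - b ≤ g T' := by
    have e1 : L * (T' - (ts + κ)) = Y := by
      have : T' - (ts + κ) = κ := by rw [hκ]; ring
      rw [this, hL]; field_simp
    simp only [hg, e1]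
    have h1 := Real.add_one_le_exp Y
    have h2 := le_abs_self (S - b)
    have h3 : 0 < 2 / D := by positivity
    linarith
  have hgts : g ts < D / 2 := by
    have e1 : L * (ts - (ts + κ)) = - Y := by
      have : ts - (ts + κ) = - κ := by ring
      rw [this, hL]; field_simp
    simp only [hg, e1, Real.exp_neg]
    have h1 := Real.add_one_le_exp Y
    have h3 : 0 < 2 / D := by positivity
    have h4 := abs_nonneg (S - b)
    have h5 : 2 / D < Real.exp Y := by linarith
    have h6 := (inv_lt_inv₀ (Real.exp_pos Y) h3).2 h5
    rwa [inv_div] at h6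
  have hts' : ts ∈ Icc 0 T' := ⟨hts.1.le, hT1.le⟩
  refine core hd hT2.le hA hm hΛ haM hH hI hmi hHi hinf hU hsub hsup (w' := w') hl0 hl1 (le_refl K) hRpos hg2 hgd
    (fun t => by positivity) (fun t ht x hx => hww t ⟨ht.1, ht.2.trans hT2.le⟩ x hx)
    (usc_u hl.le (hv.mono hsubset) hg2.continuous) (hnw.mono hsubset) (b := b) ?_ hts'
    (xs := xs) ⟨subset_closure hxs, by simpa using (by linarith : ‖xs‖ ≤ R)⟩ ?_
  · intro t ht x hx hnot
    have htT : t ∈ Icc 0 T := ⟨ht.1, ht.2.trans hT2.le⟩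
    by_cases hxU : x ∈ U
    · rcases eq_or_lt_of_le ht.1 with h0 | h0
      · exact hbdry t htT x (Or.inl ⟨h0.symm, hxU⟩) (g t) (hgpos t)
      · rcases eq_or_lt_of_le ht.2 with h1 | h1
        · have h2 := hS ⟨(t, x), ⟨ht, hx⟩, rfl⟩
          simp only at h2
          rw [← h1] at hgT
          linarith
        · apply hgrow t htT x hxU _ (g t) (hgpos t)
          by_contra hlt
          exact hnot ⟨⟨h0, h1⟩, hxU, by simpa using hlt⟩
    · refine hbdry t htT x (Or.inr ⟨⟨ht.1, ht.2.trans_lt hT2⟩, ?_⟩) (g t) (hgpos t)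
      rw [hU.frontier_eq]
      exact ⟨hx.1, hxU⟩
  · rw [hww ts ⟨hts.1.le, hts.2.le⟩ xs hxs, hb]
    nlinarith
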